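/- arXiv:1202.6310 — 5 statements merged into one kernel-verified Lean document; each statement's English description precedes it below -/
import Mathlib

section
/- Let K be a compact Hausdorff space of weight ω₁. If X ⊆ C_p(K) is locally countable, separable, and scattered, then X is countable. -/
open Set Topology Ordinal Cardinal

noncomputable section
universe u

/-- A topological space is *scattered* if every nonempty subset has a point isolated
in the subspace topology, i.e. there is an open set meeting the subset in exactly
that point. -/
def IsScattered (X : Type*) [TopologicalSpace X] : Prop :=
  ∀ S : Set X, S.Nonempty → ∃ x ∈ S, ∃ U : Set X, IsOpen U ∧ U ∩ S = {x}

/-- A space is *meta-Lindelöf* if every open cover has a point-countable open refinement. -/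
def IsMetaLindelof (X : Type*) [TopologicalSpace X] : Prop :=
  ∀ 𝒰 : Set (Set X), (∀ U ∈ 𝒰, IsOpen U) → ⋃₀ 𝒰 = Set.univ →
    ∃ 𝒱 : Set (Set X), (∀ V ∈ 𝒱, IsOpen V) ∧ ⋃₀ 𝒱 = Set.univ ∧
      (∀ V ∈ 𝒱, ∃ U ∈ 𝒰, V ⊆ U) ∧ ∀ x : X, {V ∈ 𝒱 | x ∈ V}.Countable

/-- A space is *hereditarily meta-Lindelöf* if every subspace is meta-Lindelöf. -/
def HereditarilyMetaLindelof (X : Type*) [TopologicalSpace X] : Prop :=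
  ∀ S : Set X, IsMetaLindelof S

/-- A space is *σ-discrete* if it is a countable union of subspaces, each of which is
discrete in its subspace topology. -/
def IsSigmaDiscrete (X : Type*) [TopologicalSpace X] : Prop :=
  ∃ D : ℕ → Set X, (⋃ n, D n) = Set.univ ∧ ∀ n, DiscreteTopology (D n)

/-- The Cantor–Bendixson derivatives `cbDeriv X α = X^(α)`: for each `β < α` we intersect
the set of non-isolated points of `X^(β)`.  This agrees with the usual transfinite
iteration: `X^(0) = X`, `X^(α+1)` is the set of non-isolated points of `X^(α)`, and at
limit ordinals one takes intersections. -/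
def cbDeriv (X : Type*) [TopologicalSpace X] (o : Ordinal) : Set X :=
  ⋂ p : {b : Ordinal // b < o},
    (cbDeriv X p.1 ∩ {x | x ∈ closure (cbDeriv X p.1 \ {x})})
termination_by o
decreasing_by exact p.2

/-- The Cantor–Bendixson height of a space: the least ordinal `α` with `X^(α) = ∅`. -/
def cbHeight (X : Type*) [TopologicalSpace X] : Ordinal :=
  sInf {o : Ordinal | cbDeriv X o = ∅}

/-- A space `X` is *Eberlein–Grothendieck* if it embeds into `C_p(K)`, the space of
continuous real-valued functions on a compact Hausdorff space `K` with the topology of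
pointwise convergence (the subspace topology from the product topology on `K → ℝ`). -/
def EberleinGrothendieck (X : Type u) [TopologicalSpace X] : Prop :=
  ∃ (K : Type u) (_ : TopologicalSpace K), CompactSpace K ∧ T2Space K ∧
    ∃ f : X → {g : K → ℝ // Continuous g}, IsEmbedding f

/-- The weight of a topological space: the least cardinality of a base for the topology. -/
def tweight (X : Type u) [TopologicalSpace X] : Cardinal.{u} :=
  sInf {c : Cardinal.{u} | ∃ B : Set (Set X), TopologicalSpace.IsTopologicalBasis B ∧ #B = c}

/-- A space is *locally countable* if every point has a countable open neighborhood. -/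
def LocallyCountable (X : Type*) [TopologicalSpace X] : Prop :=
  ∀ x : X, ∃ U : Set X, IsOpen U ∧ x ∈ U ∧ U.Countable

/-- A locally countable Lindelöf space is countable. -/
theorem LocallyCountable.countable {X : Type*} [TopologicalSpace X] [LindelofSpace X]
    (h : LocallyCountable X) : Countable X := by
  choose U hUo hxU hUc using h
  obtain ⟨t, ht, hcov⟩ := isLindelof_univ.elim_nhds_subcover U
    (fun x _ => (hUo x).mem_nhds (hxU x))
  exact countable_univ_iff.1 ((ht.biUnion fun x _ => hUc x).mono hcov.2)

/-- A pointwise limit of functions from `D` takes equal values at two points which are not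
separated by `D`. -/
theorem eq_of_mem_closure_of_forall_eq {K : Type*} {p : (K → ℝ) → Prop} {D : Set (Subtype p)}
    {f : Subtype p} (hf : f ∈ closure D) {a b : K} (h : ∀ d ∈ D, d.1 a = d.1 b) :
    f.1 a = f.1 b := by
  have hcl : IsClosed {g : Subtype p | g.1 a = g.1 b} :=
    isClosed_eq ((continuous_apply a).comp continuous_subtype_val)
      ((continuous_apply b).comp continuous_subtype_val)
  exact closure_minimal h hcl hf

/-- For compact `K`, every subspace of `C_p(K)` contained in the closure of a countable set is
Lindelöf. -/
theorem isLindelof_of_subset_closure_countable {K : Type*} [TopologicalSpace K] [CompactSpace K]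
    {D X : Set {g : K → ℝ // Continuous g}} (hD : D.Countable) (hX : X ⊆ closure D) :
    IsLindelof X := by
  have : Countable D := hD.to_subtype
  -- the quotient of `K` by the relation of not being separated by `D` is metrizable
  let π : K → D → ℝ := fun k d => d.1.1 k
  have hπ : Continuous π := continuous_pi fun d => d.1.2
  have : CompactSpace (range π) := isCompact_iff_compactSpace.1 (isCompact_range hπ)
  let q : C(K, range π) := ⟨rangeFactorization π, hπ.rangeFactorization⟩
  have hq : IsQuotientMap q :=
    q.continuous.isClosedMap.isQuotientMap q.continuous rangeFactorization_surjective
  let G : C(range π, ℝ) → {g : K → ℝ // Continuous g} :=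
    fun g => ⟨g ∘ q, g.continuous.comp q.continuous⟩
  have hG : Continuous G := Continuous.subtype_mk
    (continuous_pi fun k => continuous_eval_const (q k)) _
  have hXG : X ⊆ range G := by
    intro f hf
    have hfac : ∀ a b, q a = q b → f.1 a = f.1 b := fun a b hab =>
      eq_of_mem_closure_of_forall_eq (hX hf) fun d hd =>
        congrFun (congrArg Subtype.val hab) ⟨d, hd⟩
    let F : C(K, ℝ) := ⟨f.1, f.2⟩
    have hF : Function.FactorsThrough F q := fun a b hab => hfac a b hab
    refine ⟨hq.lift F hF, Subtype.ext ?_⟩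
    exact congrArg DFunLike.coe (hq.lift_comp F hF)
  rw [← image_preimage_eq_of_subset hXG]
  exact (HereditarilyLindelofSpace.isLindelof _).image hG

/-- Let `K` be a compact Hausdorff space of weight `ω₁`.  If `X ⊆ C_p(K)` is locally
countable, separable and scattered, then `X` is countable. -/
theorem countable_of_locallyCountable_separable_scattered_in_Cp
    (K : Type u) [TopologicalSpace K] [CompactSpace K] [T2Space K]
    (hw : tweight K = Cardinal.aleph 1)
    (X : Set {g : K → ℝ // Continuous g})
    (hlc : LocallyCountable X)
    (hsep : TopologicalSpace.SeparableSpace X)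
    (hsc : IsScattered X) :
    X.Countable := by
  obtain ⟨D, hDc, hD⟩ := hsep
  have hX : IsLindelof X := isLindelof_of_subset_closure_countable
    (hDc.image Subtype.val) fun x hx => by
      simpa using image_closure_subset_closure_image continuous_subtype_val
        (mem_image_of_mem Subtype.val (hD ⟨x, hx⟩))
  have : LindelofSpace X := isLindelof_iff_lindelofSpace.1 hX
  exact hlc.countable.to_set
end
end

section
/- Let K be a scattered compact Hausdorff space of weight ω₁. Then C_p(K) has the SLD property with respect to the uniform metric if and only if for every ε>0 there exists a countable family {X_n : n∈ω} covering C_p(K,{0,1}) such that for each n∈ω the set X_n admits an ε-open partitioning of length ω₁. -/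
open Set Topology Ordinal Cardinal

noncomputable section
universe u

variable {K : Type u} [TopologicalSpace K]

/-- The uniform metric on `C(K)`: `d(f,g) = min {1, sup_{x ∈ K} |f x - g x|}`. -/
def unifDist (f g : {g : K → ℝ // Continuous g}) : ℝ :=
  min 1 (⨆ x : K, |f.1 x - g.1 x|)

/-- The diameter of a set of continuous functions with respect to the uniform metric. -/
def unifDiam (A : Set {g : K → ℝ // Continuous g}) : ℝ :=
  sSup {d : ℝ | ∃ f ∈ A, ∃ g ∈ A, d = unifDist f g}

/-- `C_p(K)` has the *SLD property* with respect to the uniform metric: for every `ε > 0`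
there is a countable cover `{X_n}` of `C_p(K)` such that each `X_n` admits a (relatively)
open cover all of whose members have uniform diameter less than `ε`. -/
def SLDuniform (K : Type u) [TopologicalSpace K] : Prop :=
  ∀ ε : ℝ, 0 < ε → ∃ Xn : ℕ → Set {g : K → ℝ // Continuous g},
    (⋃ n, Xn n) = Set.univ ∧
    ∀ n, ∃ 𝒱 : Set (Set {g : K → ℝ // Continuous g}),
      (∀ V ∈ 𝒱, IsOpen V) ∧ Xn n ⊆ ⋃₀ 𝒱 ∧ ∀ V ∈ 𝒱, unifDiam (V ∩ Xn n) < ε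

/-- An *ε-open partitioning of length `α`* of `Y`: an increasing family `{U_β : β < α}` of
nonempty relatively open subsets of `Y` covering `Y` such that for every `γ < α` the
uniform diameter of `U_γ \ ⋃_{β<γ} U_β` is less than `ε`. -/
def HasEpsOpenPartitioning (Y : Set {g : K → ℝ // Continuous g}) (ε : ℝ) (α : Ordinal) :
    Prop :=
  ∃ U : Ordinal → Set {g : K → ℝ // Continuous g},
    (∀ β < α, (U β).Nonempty) ∧
    (∀ β < α, ∃ O, IsOpen O ∧ U β = O ∩ Y) ∧
    (∀ β γ : Ordinal, β ≤ γ → γ < α → U β ⊆ U γ) ∧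
    (⋃ β ∈ Set.Iio α, U β) = Y ∧
    ∀ γ < α, unifDiam (U γ \ ⋃ β ∈ Set.Iio γ, U β) < ε

open TopologicalSpace (Clopens)

theorem countable_Iio_of_lt_omega_one {o : Ordinal} (h : o < ω₁) : (Set.Iio o).Countable := by
  rw [← Cardinal.le_aleph0_iff_set_countable, Cardinal.mk_Iio_ordinal, Cardinal.lift_le_aleph0]
  rwa [← Cardinal.ord_aleph, Cardinal.lt_ord, ← Cardinal.succ_aleph0, Order.lt_succ_iff] at h

/-- A type of cardinality at most `ℵ₁` embeds into the ordinals below `ω₁`. -/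
theorem exists_injective_Iio_omega_one {α : Type u} (h : #α ≤ ℵ₁) :
    ∃ e : α → Set.Iio (ω₁ : Ordinal.{v}), Function.Injective e := by
  have : Nonempty (α ↪ Set.Iio (ω₁ : Ordinal.{v})) := by
    rw [← Cardinal.lift_mk_le', Cardinal.mk_Iio_ordinal, Ordinal.card_omega]
    simpa using h
  exact ⟨this.some, this.some.injective⟩

/-- The number of clopen sets of a compact space is bounded by its (uncountable) weight. -/
theorem mk_clopens_le [CompactSpace K] (hw : tweight K = ℵ₁) : #(Clopens K) ≤ ℵ₁ := by
  have hne : {c : Cardinal.{u} | ∃ B : Set (Set K),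
      TopologicalSpace.IsTopologicalBasis B ∧ #B = c}.Nonempty :=
    ⟨_, _, TopologicalSpace.isTopologicalBasis_opens, rfl⟩
  obtain ⟨B, hB, hBc⟩ := csInf_mem hne
  change #B = tweight K at hBc
  rw [hw] at hBc
  have hfin (A : Clopens K) : ∃ t : Finset B, (A : Set K) = ⋃₀ (Subtype.val '' (t : Set B)) :=
    eq_sUnion_finset_of_isTopologicalBasis_of_isCompact_open B hB A
      A.isClopen.isClosed.isCompact A.isClopen.isOpen
  choose t ht using hfin
  have hinj : Function.Injective t := fun A A' h => by
    apply SetLike.coe_injective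
    rw [ht A, ht A', h]
  have : Infinite B := by
    rw [← Cardinal.aleph0_le_mk_iff, hBc]
    exact Cardinal.aleph0_le_aleph 1
  calc #(Clopens K) ≤ #(Finset B) := Cardinal.mk_le_of_injective hinj
    _ = ℵ₁ := by rw [Cardinal.mk_finset_of_infinite, hBc]

/-- The clopen sets that do not separate points which `S` does not separate. -/
def clopenHull (S : Set (Clopens K)) : Set (Clopens K) :=
  {A | ∀ p q : K, (∀ B ∈ S, p ∈ B ↔ q ∈ B) → (p ∈ A ↔ q ∈ A)}

theorem subset_clopenHull (S : Set (Clopens K)) : S ⊆ clopenHull S :=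
  fun _ hA _ _ h => h _ hA

theorem clopenHull_mono {S T : Set (Clopens K)} (h : S ⊆ T) : clopenHull S ⊆ clopenHull T :=
  fun _ hA p q hpq => hA p q fun B hB => hpq B (h hB)

theorem clopenHull_finite (T : Finset (Clopens K)) :
    (clopenHull (T : Set (Clopens K))).Finite := by
  let Φ : Clopens K → Set (Set T) := fun A => {P | ∃ p ∈ A, P = {B | p ∈ B.1}}
  refine Set.Finite.of_injOn (f := Φ) (t := Set.univ) (fun _ _ => Set.mem_univ _) ?_
    Set.finite_univ
  have key : ∀ A ∈ clopenHull (T : Set (Clopens K)), ∀ A', Φ A = Φ A' → ∀ p ∈ A', p ∈ A := by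
    intro A hA A' h p hp
    have hmem : {B : T | p ∈ B.1} ∈ Φ A := by rw [h]; exact ⟨p, hp, rfl⟩
    obtain ⟨q, hq, hpq⟩ := hmem
    refine (hA p q fun B hB => ?_).2 hq
    have := Set.ext_iff.1 hpq ⟨B, hB⟩
    simpa using this
  intro A hA A' hA' h
  ext p
  exact ⟨key A' hA' A h.symm p, key A hA A' h p⟩

/-- Compactness: membership in a hull is witnessed by finitely many clopen sets. -/
theorem exists_finset_mem_clopenHull [CompactSpace K] {S : Set (Clopens K)} {A : Clopens K}
    (hA : A ∈ clopenHull S) :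
    ∃ T : Finset (Clopens K), (T : Set (Clopens K)) ⊆ S ∧ A ∈ clopenHull (T : Set (Clopens K)) := by
  have hsep (B : Clopens K) : IsClopen {z : K × K | z.1 ∈ B ↔ z.2 ∈ B} := by
    have h1 : IsClopen {z : K × K | z.1 ∈ B} := B.isClopen.preimage continuous_fst
    have h2 : IsClopen {z : K × K | z.2 ∈ B} := B.isClopen.preimage continuous_snd
    have : {z : K × K | z.1 ∈ B ↔ z.2 ∈ B} =
        ({z : K × K | z.1 ∈ B} ∩ {z : K × K | z.2 ∈ B}) ∪
          ({z : K × K | z.1 ∈ B}ᶜ ∩ {z : K × K | z.2 ∈ B}ᶜ) := by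
      ext z; simp; tauto
    rw [this]
    exact (h1.inter h2).union (h1.compl.inter h2.compl)
  obtain ⟨t, ht⟩ := (hsep A).compl.isClosed.isCompact.elim_finite_subfamily_closed
    (fun B : S => {z : K × K | z.1 ∈ B.1 ↔ z.2 ∈ B.1}) (fun B => (hsep B.1).isClosed) (by
      rw [Set.eq_empty_iff_forall_notMem]
      rintro ⟨p, q⟩ ⟨h1, h2⟩
      exact h1 (hA p q fun B hB => Set.mem_iInter.1 h2 ⟨B, hB⟩))
  classical
  refine ⟨t.image Subtype.val, by simp, fun p q hpq => ?_⟩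
  by_contra hne
  refine Set.eq_empty_iff_forall_notMem.1 ht (p, q) ⟨hne, ?_⟩
  simp only [Set.mem_iInter]
  intro B hB
  exact hpq B.1 (by simpa using hB)

theorem clopenHull_countable [CompactSpace K] {S : Set (Clopens K)} (hS : S.Countable) :
    (clopenHull S).Countable := by
  have : (⋃ T ∈ {T : Set (Clopens K) | T.Finite ∧ T ⊆ S}, clopenHull T).Countable :=
    (Set.countable_ofPred_finite_subset hS).biUnion fun T hT => by
      have := (clopenHull_finite hT.1.toFinset).countable
      rwa [hT.1.coe_toFinset] at this
  refine this.mono fun A hA => ?_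
  obtain ⟨T, hT, hAT⟩ := exists_finset_mem_clopenHull hA
  exact Set.mem_biUnion (x := (T : Set (Clopens K))) ⟨T.finite_toSet, hT⟩ hAT

/-- If there are at most `ℵ₁` clopen sets, then the space of clopen sets, with the topology
of pointwise convergence, has a point-countable assignment of basic neighbourhoods. -/
theorem exists_pointCountable_nhds [CompactSpace K] (h : #(Clopens K) ≤ ℵ₁) :
    ∃ N : Clopens K → Set K, (∀ A, (N A).Finite) ∧
      ∀ B : Clopens K, {A : Clopens K | ∀ x ∈ N A, x ∈ B ↔ x ∈ A}.Countable := by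
  obtain ⟨e, he⟩ := exists_injective_Iio_omega_one.{u, 0} h
  let H : Ordinal → Set (Clopens K) := fun o => clopenHull {A | (e A).1 < o}
  have hmono {a b : Ordinal} (hab : a ≤ b) : H a ⊆ H b :=
    clopenHull_mono fun A (hA : (e A).1 < a) => hA.trans_le hab
  have hlim := Cardinal.isSuccLimit_omega 1
  have hmem (A : Clopens K) : A ∈ H (Order.succ (e A).1) :=
    subset_clopenHull _ (Order.lt_succ (e A).1)
  have hcount {a : Ordinal} (ha : a < ω₁) : (H a).Countable := by
    refine clopenHull_countable ?_
    exact (countable_Iio_of_lt_omega_one ha).preimage_of_injOn (f := fun A => (e A).1)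
      (fun A _ A' _ hAA => he (Subtype.ext hAA))
  let ρ : Clopens K → Ordinal := fun A => sInf {o | A ∈ H o}
  have hρmem (A) : A ∈ H (ρ A) := csInf_mem (s := {o | A ∈ H o}) ⟨_, hmem A⟩
  have hρlt (A) : ρ A < ω₁ :=
    (csInf_le' (s := {o | A ∈ H o}) (hmem A)).trans_lt (hlim.succ_lt (e A).2)
  have hN (A : Clopens K) : ∃ F : Set K, F.Finite ∧
      ∀ B : Clopens K, (∀ x ∈ F, x ∈ B ↔ x ∈ A) → ρ A ≤ ρ B := by
    obtain ⟨T, hT, hAT⟩ := exists_finset_mem_clopenHull (hρmem A)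
    rcases T.eq_empty_or_nonempty with rfl | hTne
    · refine ⟨∅, Set.finite_empty, fun B _ => ?_⟩
      have : A ∈ H 0 := clopenHull_mono (by simp) hAT
      exact (csInf_le' (s := {o | A ∈ H o}) this).trans zero_le
    · obtain ⟨C, hC, hCmax⟩ := T.exists_max_image (fun B => (e B).1) hTne
      have hCρ : (e C).1 < ρ A := hT hC
      have hAH : A ∈ H (Order.succ (e C).1) :=
        clopenHull_mono (fun B hB => Order.lt_succ_of_le (hCmax B hB)) hAT
      have hAn : A ∉ H (e C).1 := fun hA' => hCρ.not_ge (csInf_le' hA')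
      have hAn' : ∃ p q : K, (∀ B ∈ {A | (e A).1 < (e C).1}, p ∈ B ↔ q ∈ B) ∧
          ¬ (p ∈ A ↔ q ∈ A) := by
        by_contra hcon
        push Not at hcon
        exact hAn fun p q hpq => by have := hcon p q hpq; tauto
      obtain ⟨p, q, hpq, hpA⟩ := hAn'
      refine ⟨{p, q}, by simp, fun B hB => ?_⟩
      have hp := hB p (by simp)
      have hq := hB q (by simp)
      have hBn : B ∉ H (e C).1 := fun hB' => hpA (by rw [← hp, ← hq]; exact hB' p q hpq)
      refine (csInf_le' (s := {o | A ∈ H o}) hAH).trans (Order.succ_le_of_lt ?_)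
      by_contra hlt
      exact hBn (hmono (not_lt.1 hlt) (hρmem B))
  choose N hNfin hNle using hN
  refine ⟨N, hNfin, fun B => (hcount (hρlt B)).mono fun A hA => ?_⟩
  exact hmono (hNle A B hA) (hρmem A)

theorem countable_reflTransGen {α : Type*} {r : α → α → Prop} (h : ∀ a, {b | r a b}.Countable)
    (a : α) : {b | Relation.ReflTransGen r a b}.Countable := by
  let S : ℕ → Set α := fun n => Nat.rec {a} (fun _ T => ⋃ b ∈ T, {c | r b c}) n
  have hS (n : ℕ) : (S n).Countable := by
    induction n with
    | zero => exact Set.countable_singleton a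
    | succ n ih => exact ih.biUnion fun b _ => h b
  refine (Set.countable_iUnion hS).mono fun b hb => ?_
  induction hb with
  | refl => exact Set.mem_iUnion.2 ⟨0, rfl⟩
  | tail _ hbc ih =>
    obtain ⟨n, hn⟩ := Set.mem_iUnion.1 ih
    exact Set.mem_iUnion.2 ⟨n + 1, Set.mem_biUnion hn hbc⟩

/-- A family of clopen sets is *pointwise discrete* if each member is determined within the
family by its trace on some finite set. -/
def PointwiseDiscrete (D : Set (Clopens K)) : Prop :=
  ∀ A ∈ D, ∃ F : Set K, F.Finite ∧ ∀ B ∈ D, (∀ x ∈ F, x ∈ B ↔ x ∈ A) → B = A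

/-- A locally countable family of clopen sets with a point-countable assignment of
neighbourhoods splits into countably many discrete families. -/
theorem exists_pointwiseDiscrete_cover {N : Clopens K → Set K} (hNfin : ∀ A, (N A).Finite)
    (hN : ∀ B : Clopens K, {A : Clopens K | ∀ x ∈ N A, x ∈ B ↔ x ∈ A}.Countable) {Y : Set (Clopens K)}
    (hY : ∀ A ∈ Y, ∃ F : Set K, F.Finite ∧ {B ∈ Y | ∀ x ∈ F, x ∈ B ↔ x ∈ A}.Countable) :
    ∃ D : ℕ → Set (Clopens K), Y ⊆ ⋃ n, D n ∧ ∀ n, PointwiseDiscrete (D n) := by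
  have hY' (A : Clopens K) : ∃ F : Set K, F.Finite ∧
      (A ∈ Y → {B ∈ Y | ∀ x ∈ F, x ∈ B ↔ x ∈ A}.Countable) := by
    by_cases hA : A ∈ Y
    · obtain ⟨F, hF, hF'⟩ := hY A hA
      exact ⟨F, hF, fun _ => hF'⟩
    · exact ⟨∅, Set.finite_empty, fun h => (hA h).elim⟩
  choose F hF hFY using hY'
  let r : Clopens K → Clopens K → Prop := fun A B =>
    A ∈ Y ∧ B ∈ Y ∧ ∀ x ∈ F A ∪ N A, x ∈ B ↔ x ∈ A
  let s : Clopens K → Clopens K → Prop := fun A B => r A B ∨ r B A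
  have hs : Std.Symm s := ⟨fun A B h => h.symm⟩
  have hcount (A) : {B | s A B}.Countable := by
    by_cases hA : A ∈ Y
    · refine ((hFY A hA).union (hN A)).mono ?_
      rintro B (hB | hB)
      · exact Or.inl ⟨hB.2.1, fun x hx => hB.2.2 x (Or.inl hx)⟩
      · exact Or.inr fun x hx => hB.2.2 x (Or.inr hx)
    · refine Set.countable_empty.mono ?_
      rintro B (hB | hB)
      · exact hA hB.1
      · exact hA hB.2.1
  let E : Setoid (Clopens K) :=
    ⟨Relation.ReflTransGen s, fun _ => .refl, fun h => Relation.ReflTransGen.stdSymm.symm _ _ h,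
      fun h h' => h.trans h'⟩
  have hinj (q : Quotient E) : ∃ f : Clopens K → ℕ, Set.InjOn f {B | Quotient.mk E B = q} := by
    apply Set.countable_iff_exists_injOn.1
    induction q using Quotient.inductionOn with
    | h A =>
      refine (countable_reflTransGen hcount A).mono fun B hB => ?_
      exact E.symm (Quotient.exact hB)
  choose f hf using hinj
  refine ⟨fun n => {A ∈ Y | f (Quotient.mk E A) A = n},
    fun A hA => Set.mem_iUnion.2 ⟨_, hA, rfl⟩, fun n A hA => ?_⟩
  refine ⟨F A ∪ N A, (hF A).union (hNfin A), fun B hB hBA => ?_⟩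
  have hAB : Quotient.mk E A = Quotient.mk E B :=
    Quotient.sound (Relation.ReflTransGen.single (Or.inl ⟨hA.1, hB.1, hBA⟩))
  refine hf (Quotient.mk E A) hAB.symm rfl ?_
  rw [hA.2]
  nth_rewrite 1 [hAB]
  exact hB.2

/-- A continuous real function on a scattered compact space omits a rational number
from every nondegenerate interval. -/
theorem exists_rat_notMem_range [CompactSpace K] [T2Space K] (hsc : IsScattered K)
    {f : K → ℝ} (hf : Continuous f) {a b : ℝ} (hab : a < b) :
    ∃ r : ℚ, a < r ∧ r < b ∧ (r : ℝ) ∉ Set.range f := by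
  by_contra hcon
  push Not at hcon
  have hsub : Set.Icc a b ⊆ Set.range f := by
    have hd : Set.Ioo a b ⊆ closure (Set.Ioo a b ∩ Set.range ((↑) : ℚ → ℝ)) :=
      Rat.denseRange_cast.open_subset_closure_inter isOpen_Ioo
    have hr : Set.Ioo a b ∩ Set.range ((↑) : ℚ → ℝ) ⊆ Set.range f := by
      rintro _ ⟨h, r, rfl⟩
      exact hcon r h.1 h.2
    rw [← closure_Ioo hab.ne]
    exact closure_minimal (hd.trans (closure_minimal hr (isCompact_range hf).isClosed))
      (isCompact_range hf).isClosed
  let D : Set K := f ⁻¹' Set.Icc a b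
  have : CompactSpace D := isCompact_iff_compactSpace.1 (isClosed_Icc.preimage hf).isCompact
  let π : D → ULift.{u} (Set.Icc a b) := fun x => ⟨⟨f x.1, x.2⟩⟩
  have hπ : Continuous π := by fun_prop
  have hπs : Function.Surjective π := by
    rintro ⟨t, ht⟩
    obtain ⟨x, rfl⟩ := hsub ht
    exact ⟨⟨x, ht⟩, rfl⟩
  obtain ⟨E, hEc, hEs, hmin⟩ := exists_compact_surjective_zorn_subset hπ hπs
  have hSne : (Subtype.val '' E).Nonempty := by
    obtain ⟨x, hx, -⟩ : (⟨⟨a, Set.left_mem_Icc.2 hab.le⟩⟩ : ULift (Set.Icc a b)) ∈ π '' E := by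
      rw [hEs]; trivial
    exact ⟨x.1, x, hx, rfl⟩
  obtain ⟨_, ⟨x, hx, rfl⟩, U, hU, hUx⟩ := hsc _ hSne
  have hUo : IsOpen {y : E | y.1.1 ∈ U} := hU.preimage (by fun_prop)
  let E₀ : Set E := {y | y.1.1 ∈ U}ᶜ
  have hE₀ : IsClosed E₀ := hUo.isClosed_compl
  have hxU : x.1 ∈ U := (hUx.symm.subset rfl).1
  refine hmin E₀ (fun h => ?_) hE₀ ?_
  · exact (h.symm.subset (Set.mem_univ (⟨x, hx⟩ : E)) : _ ∉ _) hxU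
  · have hcl : IsClosed (E.domRestrict π '' E₀) :=
      (hE₀.isCompact.image (hπ.comp continuous_subtype_val)).isClosed
    have hcompl : {π x}ᶜ ⊆ E.domRestrict π '' E₀ := by
      intro t ht
      obtain ⟨y, hy, rfl⟩ := hEs.symm.subset (Set.mem_univ t)
      refine ⟨⟨y, hy⟩, fun hyU => ht ?_, rfl⟩
      have : y.1 ∈ ({x.1} : Set K) := hUx.subset ⟨hyU, y, hy, rfl⟩
      rw [Subtype.ext this]
      rfl
    have : Fact (a ≤ b) := ⟨hab.le⟩
    have : Nontrivial (Set.Icc a b) :=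
      ⟨⟨a, Set.left_mem_Icc.2 hab.le⟩, ⟨b, Set.right_mem_Icc.2 hab.le⟩,
        fun h => hab.ne (congrArg Subtype.val h)⟩
    have : ConnectedSpace (Set.Icc a b) := Subtype.connectedSpace (isConnected_Icc hab.le)
    have : ConnectedSpace (ULift.{u} (Set.Icc a b)) :=
      (Homeomorph.ulift (X := Set.Icc a b)).symm.surjective.connectedSpace
        Homeomorph.ulift.symm.continuous
    exact Set.univ_subset_iff.1
      ((dense_compl_singleton (π x)).closure_eq ▸ closure_minimal hcompl hcl)

theorem unifDist_nonneg (f g : {g : K → ℝ // Continuous g}) : 0 ≤ unifDist f g :=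
  le_min zero_le_one (Real.iSup_nonneg fun _ => abs_nonneg _)

theorem unifDist_le_unifDiam {A : Set {g : K → ℝ // Continuous g}}
    {f g : {g : K → ℝ // Continuous g}} (hf : f ∈ A) (hg : g ∈ A) :
    unifDist f g ≤ unifDiam A :=
  le_csSup ⟨1, by rintro _ ⟨_, _, _, _, rfl⟩; exact min_le_left _ _⟩ ⟨f, hf, g, hg, rfl⟩

theorem unifDiam_le {A : Set {g : K → ℝ // Continuous g}} {c : ℝ} (hc : 0 ≤ c)
    (h : ∀ f ∈ A, ∀ g ∈ A, unifDist f g ≤ c) : unifDiam A ≤ c :=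
  Real.sSup_le (by rintro _ ⟨f, hf, g, hg, rfl⟩; exact h f hf g hg) hc

theorem unifDiam_nonneg (A : Set {g : K → ℝ // Continuous g}) : 0 ≤ unifDiam A :=
  Real.sSup_nonneg (by rintro _ ⟨f, _, g, _, rfl⟩; exact unifDist_nonneg f g)

theorem unifDiam_mono {A B : Set {g : K → ℝ // Continuous g}} (h : A ⊆ B) :
    unifDiam A ≤ unifDiam B :=
  unifDiam_le (unifDiam_nonneg B) fun _ hf _ hg => unifDist_le_unifDiam (h hf) (h hg)

/-- Finitely many rational cuts outside the range of a bounded function, each gap of length `ε`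
in `[-M, M]` being cut. -/
theorem exists_rat_cuts [CompactSpace K] [T2Space K] (hsc : IsScattered K)
    {f : K → ℝ} (hf : Continuous f) {ε : ℝ} (hε : 0 < ε) (M : ℝ) :
    ∃ R : Finset ℚ, (∀ r ∈ R, (r : ℝ) ∉ Set.range f) ∧
      ∀ u v : ℝ, |u| ≤ M → u + ε ≤ v → ∃ r ∈ R, u < r ∧ r < v := by
  obtain ⟨δ, hδ, rfl⟩ : ∃ δ : ℝ, 0 < δ ∧ ε = 2 * δ := ⟨ε / 2, by positivity, by ring⟩
  have hcut (j : ℤ) := exists_rat_notMem_range hsc hf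
    (show (j : ℝ) * δ < (j + 1) * δ by nlinarith)
  choose r hr1 hr2 hr3 using hcut
  refine ⟨(Finset.Icc (⌊-M / δ⌋ + 1) (⌊M / δ⌋ + 1)).image r, ?_, fun u v hu huv => ?_⟩
  · intro q hq
    obtain ⟨j, -, rfl⟩ := Finset.mem_image.1 hq
    exact hr3 j
  · rw [abs_le] at hu
    refine ⟨r (⌊u / δ⌋ + 1), Finset.mem_image_of_mem _ (Finset.mem_Icc.2 ⟨?_, ?_⟩), ?_, ?_⟩
    · have : -M / δ ≤ u / δ := by gcongr; exact hu.1
      have := Int.floor_mono this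
      lia
    · have : u / δ ≤ M / δ := by gcongr; exact hu.2
      have := Int.floor_mono this
      lia
    · have h1 := Int.lt_floor_add_one (u / δ)
      rw [div_lt_iff₀ hδ] at h1
      have h2 := hr1 (⌊u / δ⌋ + 1)
      push_cast at h2
      linarith
    · have h1 := Int.floor_le (u / δ)
      rw [le_div_iff₀ hδ] at h1
      have h2 := hr2 (⌊u / δ⌋ + 1)
      push_cast at h2
      nlinarith

/-- If the clopen sets split into countably many pointwise discrete families, then `C_p(K)` is
SLD for scattered compact `K`. -/
theorem SLDuniform_of_pointwiseDiscrete_cover [CompactSpace K] [T2Space K] (hsc : IsScattered K)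
    {D : ℕ → Set (Clopens K)} (hD : ∀ A, ∃ n, A ∈ D n) (hD' : ∀ n, PointwiseDiscrete (D n)) :
    SLDuniform K := by
  intro ε hε
  let X : Finset (ℚ × ℕ) × ℕ → Set {g : K → ℝ // Continuous g} := fun i =>
    {f | (∀ x, |f.1 x| ≤ i.2) ∧
      (∀ p ∈ i.1, (p.1 : ℝ) ∉ Set.range f.1 ∧
        ∃ A ∈ D p.2, ∀ x, x ∈ A ↔ (p.1 : ℝ) < f.1 x) ∧
      ∀ u v : ℝ, |u| ≤ i.2 → u + ε / 2 ≤ v → ∃ p ∈ i.1, u < p.1 ∧ p.1 < v}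
  obtain ⟨s, hs⟩ := exists_surjective_nat (Finset (ℚ × ℕ) × ℕ)
  refine ⟨fun n => X (s n), ?_, fun n => ?_⟩
  · rw [Set.eq_univ_iff_forall]
    intro f
    obtain ⟨C, hC⟩ := isCompact_univ.exists_bound_of_continuousOn f.2.continuousOn
    obtain ⟨M, hM⟩ := exists_nat_ge C
    obtain ⟨R, hR, hR'⟩ := exists_rat_cuts hsc f.2 (half_pos hε) M
    have hA (r : ℚ) : ∃ n, r ∈ R → ∃ A ∈ D n, ∀ x, x ∈ A ↔ (r : ℝ) < f.1 x := by
      by_cases hr : r ∈ R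
      · have hcl : IsClopen {x | (r : ℝ) < f.1 x} := by
          refine ⟨?_, isOpen_lt continuous_const f.2⟩
          have : {x | (r : ℝ) < f.1 x} = {x | (r : ℝ) ≤ f.1 x} := by
            ext x
            exact ⟨fun h => le_of_lt (show (r : ℝ) < f.1 x from h), fun h => lt_of_le_of_ne h fun h' => hR r hr ⟨x, h'.symm⟩⟩
          rw [this]
          exact isClosed_le continuous_const f.2
        obtain ⟨n, hn⟩ := hD ⟨_, hcl⟩
        exact ⟨n, fun _ => ⟨_, hn, fun x => Iff.rfl⟩⟩
      · exact ⟨0, fun h => (hr h).elim⟩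
    choose N hN using hA
    obtain ⟨n, hn⟩ := hs (R.image fun r => (r, N r), M)
    refine Set.mem_iUnion.2 ⟨n, ?_⟩
    rw [hn]
    refine ⟨fun x => (hC x trivial).trans hM, ?_, fun u v hu huv => ?_⟩
    · intro p hp
      obtain ⟨r, hr, rfl⟩ := Finset.mem_image.1 hp
      exact ⟨hR r hr, hN r hr⟩
    · obtain ⟨r, hr, hr'⟩ := hR' u v hu huv
      exact ⟨_, Finset.mem_image_of_mem _ hr, hr'⟩
  · show ∃ 𝒱 : Set (Set {g : K → ℝ // Continuous g}),
      (∀ V ∈ 𝒱, IsOpen V) ∧ X (s n) ⊆ ⋃₀ 𝒱 ∧ ∀ V ∈ 𝒱, unifDiam (V ∩ X (s n)) < ε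
    generalize s n = i
    refine ⟨{O | IsOpen O ∧ unifDiam (O ∩ X i) < ε}, fun _ h => h.1, fun f hf => ?_,
      fun _ h => h.2⟩
    have hF (p : ℚ × ℕ) : ∃ F : Set K, F.Finite ∧ (p ∈ i.1 →
        ∀ B ∈ D p.2, (∀ x ∈ F, x ∈ B ↔ (p.1 : ℝ) < f.1 x) → ∀ x, x ∈ B ↔ (p.1 : ℝ) < f.1 x) := by
      by_cases hp : p ∈ i.1
      · obtain ⟨-, A, hA, hAf⟩ := hf.2.1 p hp
        obtain ⟨F, hFfin, hFA⟩ := hD' _ A hA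
        refine ⟨F, hFfin, fun _ B hB hBF => ?_⟩
        rw [hFA B hB fun x hx => (hBF x hx).trans (hAf x).symm]
        exact hAf
      · exact ⟨∅, Set.finite_empty, fun h => (hp h).elim⟩
    choose F hFfin hF using hF
    let O : Set {g : K → ℝ // Continuous g} := ⋂ p ∈ i.1, ⋂ x ∈ F p,
      {g | ((p.1 : ℝ) < f.1 x → (p.1 : ℝ) < g.1 x) ∧ (f.1 x < p.1 → g.1 x < p.1)}
    have hO : IsOpen O := by
      refine isOpen_biInter_finset fun p _ => (hFfin p).isOpen_biInter fun x _ => ?_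
      have hx : Continuous fun g : {g : K → ℝ // Continuous g} => g.1 x :=
        (continuous_apply x).comp continuous_subtype_val
      refine IsOpen.and ?_ ?_
      · by_cases h : (p.1 : ℝ) < f.1 x
        · simpa only [h, true_imp_iff] using isOpen_lt continuous_const hx
        · simp [h]
      · by_cases h : f.1 x < p.1
        · simpa only [h, true_imp_iff] using isOpen_lt hx continuous_const
        · simp [h]
    have hcut : ∀ g ∈ O ∩ X i, ∀ p ∈ i.1, ∀ x, (p.1 : ℝ) < g.1 x ↔ (p.1 : ℝ) < f.1 x := by
      rintro g ⟨hgO, hgX⟩ p hp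
      obtain ⟨-, B, hB, hBg⟩ := hgX.2.1 p hp
      have := hF p hp B hB fun x hx => by
        have hgx := Set.mem_iInter₂.1 (Set.mem_iInter₂.1 hgO p hp) x hx
        rw [hBg]
        refine ⟨fun h => ?_, hgx.1⟩
        by_contra h'
        have hne : f.1 x ≠ p.1 := fun h => (hf.2.1 p hp).1 ⟨x, h⟩
        exact h.not_gt (hgx.2 (lt_of_le_of_ne (not_lt.1 h') hne))
      exact fun x => (hBg x).symm.trans (this x)
    refine ⟨O, ⟨hO, ?_⟩, ?_⟩
    · refine (unifDiam_le (half_pos hε).le fun g hg h hh => ?_).trans_lt (half_lt_self hε)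
      refine (min_le_right _ _).trans (Real.iSup_le (fun x => ?_) (half_pos hε).le)
      have key : ∀ g ∈ O ∩ X i, ∀ h ∈ O ∩ X i, h.1 x - g.1 x ≤ ε / 2 := by
        intro g hg h hh
        by_contra hlt
        obtain ⟨p, hp, h1, h2⟩ := hg.2.2.2 (g.1 x) (h.1 x) (hg.2.1 x) (by linarith)
        exact h1.not_gt ((hcut g hg p hp x).2 ((hcut h hh p hp x).1 h2))
      rw [abs_le]
      have := key g hg h hh
      have := key h hh g hg
      constructor <;> linarith
    · exact Set.mem_iInter₂.2 fun p _ => Set.mem_iInter₂.2 fun x _ => ⟨id, id⟩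

/-- The characteristic function of a clopen set. -/
def clopenChar (A : Clopens K) : {g : K → ℝ // Continuous g} :=
  ⟨(A : Set K).indicator fun _ => 1, A.isClopen.continuous_indicator continuous_const⟩

theorem clopenChar_eq_zero_or_one (A : Clopens K) (x : K) :
    (clopenChar A).1 x = 0 ∨ (clopenChar A).1 x = 1 :=
  Set.indicator_eq_zero_or_self (A : Set K) (fun _ => (1 : ℝ)) x

theorem clopenChar_apply_eq_iff {A B : Clopens K} {x : K} :
    (clopenChar A).1 x = (clopenChar B).1 x ↔ (x ∈ A ↔ x ∈ B) := by
  classical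
  simp only [clopenChar, Set.indicator_apply, SetLike.mem_coe]
  split_ifs <;> simp_all

theorem exists_clopenChar_eq {f : {g : K → ℝ // Continuous g}} (hf : ∀ x, f.1 x = 0 ∨ f.1 x = 1) :
    ∃ A, clopenChar A = f := by
  have hcl : IsClopen {x | (0 : ℝ) < f.1 x} := by
    refine ⟨?_, isOpen_lt continuous_const f.2⟩
    have : {x | (0 : ℝ) < f.1 x} = {x | 1 ≤ f.1 x} := by
      ext x
      rcases hf x with h | h <;> simp [h]
    rw [this]
    exact isClosed_le continuous_const f.2
  refine ⟨⟨_, hcl⟩, Subtype.ext (funext fun x => ?_)⟩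
  classical
  rcases hf x with h | h <;> simp [clopenChar, h]

theorem eq_of_unifDist_clopenChar_lt_one {A B : Clopens K}
    (h : unifDist (clopenChar A) (clopenChar B) < 1) : A = B := by
  by_contra hne
  obtain ⟨x, hx⟩ : ∃ x, ¬ (x ∈ A ↔ x ∈ B) := by
    by_contra hcon
    push Not at hcon
    exact hne (SetLike.ext fun x => by have := hcon x; tauto)
  have hval : |(clopenChar A).1 x - (clopenChar B).1 x| = 1 := by
    rw [← clopenChar_apply_eq_iff] at hx
    rcases clopenChar_eq_zero_or_one A x with h1 | h1 <;>
      rcases clopenChar_eq_zero_or_one B x with h2 | h2 <;> simp_all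
  have hbdd : BddAbove (Set.range fun x => |(clopenChar A).1 x - (clopenChar B).1 x|) := by
    refine ⟨1, ?_⟩
    rintro _ ⟨y, rfl⟩
    dsimp only
    rcases clopenChar_eq_zero_or_one A y with h1 | h1 <;>
      rcases clopenChar_eq_zero_or_one B y with h2 | h2 <;> simp [h1, h2]
  have hle := le_ciSup hbdd x
  rw [hval] at hle
  exact h.not_ge (le_min le_rfl hle)

theorem exists_finite_of_mem_isOpen {O : Set {g : K → ℝ // Continuous g}} (hO : IsOpen O)
    {f : {g : K → ℝ // Continuous g}} (hf : f ∈ O) :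
    ∃ F : Set K, F.Finite ∧ ∀ g : {g : K → ℝ // Continuous g},
      (∀ x ∈ F, g.1 x = f.1 x) → g ∈ O := by
  obtain ⟨O', hO', rfl⟩ := isOpen_induced_iff.1 hO
  obtain ⟨F, u, hu, huO⟩ := isOpen_pi_iff.1 hO' f.1 hf
  exact ⟨F, F.finite_toSet, fun g hg => huO fun x hx => by rw [hg x hx]; exact (hu x hx).2⟩

/-- An open partitioning of length `ω₁` into sets of diameter less than `1` makes the
`{0, 1}`-valued part locally countable. -/
theorem HasEpsOpenPartitioning.locally_countable {Y : Set {g : K → ℝ // Continuous g}}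
    (h : HasEpsOpenPartitioning Y 1 ω₁) {A : Clopens K} (hA : clopenChar A ∈ Y) :
    ∃ F : Set K, F.Finite ∧
      {B | clopenChar B ∈ Y ∧ ∀ x ∈ F, x ∈ B ↔ x ∈ A}.Countable := by
  obtain ⟨U, -, hopen, -, hcov, hdiam⟩ := h
  rw [← hcov] at hA
  obtain ⟨γ, hγ, hAγ⟩ := Set.mem_iUnion₂.1 hA
  obtain ⟨O, hO, hUO⟩ := hopen γ hγ
  obtain ⟨F, hF, hFO⟩ := exists_finite_of_mem_isOpen hO (hUO.subset hAγ).1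
  refine ⟨F, hF, ?_⟩
  have hlim := Cardinal.isSuccLimit_omega 1
  have hc : (⋃ β ∈ Set.Iio (Order.succ γ),
      {B | clopenChar B ∈ U β \ ⋃ α ∈ Set.Iio β, U α}).Countable := by
    refine (countable_Iio_of_lt_omega_one (hlim.succ_lt hγ)).biUnion fun β hβ => ?_
    refine Set.Subsingleton.countable fun B hB C hC => ?_
    exact eq_of_unifDist_clopenChar_lt_one ((unifDist_le_unifDiam hB hC).trans_lt
      (hdiam β ((Order.lt_succ_iff.1 hβ).trans_lt hγ)))
  refine hc.mono fun B hB => ?_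
  have hBγ : clopenChar B ∈ U γ :=
    hUO.symm.subset ⟨hFO _ fun x hx => clopenChar_apply_eq_iff.2 (hB.2 x hx), hB.1⟩
  have hmem := csInf_mem (s := {β | clopenChar B ∈ U β}) ⟨γ, hBγ⟩
  have hle : sInf {β | clopenChar B ∈ U β} ≤ γ := csInf_le' hBγ
  refine Set.mem_biUnion (Order.lt_succ_iff.2 hle) ⟨hmem, fun hB' => ?_⟩
  obtain ⟨α, hα, hBα⟩ := Set.mem_iUnion₂.1 hB'
  exact (show α < _ from hα).not_ge (csInf_le' hBα)

/-- A nonempty set of at most `ℵ₁` functions which has a relatively open cover by sets of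
small diameter has an open partitioning of length `ω₁`. -/
theorem hasEpsOpenPartitioning_of_cover {Y : Set {g : K → ℝ // Continuous g}} {ε : ℝ}
    (hne : Y.Nonempty) (hcard : #Y ≤ ℵ₁)
    (h : ∀ f ∈ Y, ∃ V, IsOpen V ∧ f ∈ V ∧ unifDiam (V ∩ Y) < ε) :
    HasEpsOpenPartitioning Y ε ω₁ := by
  obtain ⟨e, he⟩ := exists_injective_Iio_omega_one hcard
  have hYne : Nonempty Y := hne.to_subtype
  choose! V hVo hVmem hVdiam using h
  let s : Ordinal → Y := Function.invFun fun y => (e y).1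
  have hs (y : Y) : s (e y).1 = y :=
    Function.leftInverse_invFun (f := fun y => (e y).1) (Subtype.val_injective.comp he) y
  refine ⟨fun γ => (⋃ β ∈ Set.Iic γ, V (s β)) ∩ Y, ?_, ?_, ?_, ?_, ?_⟩
  · intro β _
    exact ⟨s β, Set.mem_biUnion (Set.mem_Iic.2 le_rfl) (hVmem _ (s β).2), (s β).2⟩
  · intro β _
    exact ⟨_, isOpen_biUnion fun α _ => hVo _ (s α).2, rfl⟩
  · intro β γ hβγ _
    exact Set.inter_subset_inter_left _
      (Set.biUnion_subset_biUnion_left (Set.Iic_subset_Iic.2 hβγ))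
  · refine Set.Subset.antisymm (Set.iUnion₂_subset fun _ _ => Set.inter_subset_right) ?_
    intro f hf
    refine Set.mem_biUnion (e ⟨f, hf⟩).2 ⟨?_, hf⟩
    refine Set.mem_biUnion (Set.mem_Iic.2 le_rfl) ?_
    rw [hs]
    exact hVmem f hf
  · intro γ _
    refine (unifDiam_mono ?_).trans_lt (hVdiam _ (s γ).2)
    rintro f ⟨⟨hf, hfY⟩, hf'⟩
    obtain ⟨β, hβ, hfβ⟩ := Set.mem_iUnion₂.1 hf
    rcases (Set.mem_Iic.1 hβ).lt_or_eq with hlt | rfl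
    · exact (hf' (Set.mem_biUnion hlt ⟨Set.mem_biUnion (Set.mem_Iic.2 le_rfl) hfβ, hfY⟩)).elim
    · exact ⟨hfβ, hfY⟩

/-- Let `K` be a scattered compact Hausdorff space of weight `ω₁`.  Then `C_p(K)` is SLD
with respect to the uniform metric iff for every `ε > 0` there is a countable family
`{X_n}` covering `C_p(K, {0,1})` such that each `X_n` admits an `ε`-open partitioning of
length `ω₁`. -/
theorem SLD_iff_epsOpenPartitionings
    [CompactSpace K] [T2Space K] (hsc : IsScattered K)
    (hw : tweight K = Cardinal.aleph 1) :
    SLDuniform K ↔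
      ∀ ε : ℝ, 0 < ε → ∃ Xn : ℕ → Set {g : K → ℝ // Continuous g},
        ({f : {g : K → ℝ // Continuous g} | ∀ x : K, f.1 x = 0 ∨ f.1 x = 1} ⊆ ⋃ n, Xn n) ∧
        ∀ n, HasEpsOpenPartitioning (Xn n) ε ω₁ := by
  have hcard := mk_clopens_le hw
  constructor
  · intro h ε hε
    obtain ⟨X, hX, hXV⟩ := h ε hε
    have hmk (Y : Set {g : K → ℝ // Continuous g}) (hY : Y ⊆ Set.range clopenChar) : #Y ≤ ℵ₁ :=
      (Cardinal.mk_le_mk_of_subset hY).trans (Cardinal.mk_range_le.trans hcard)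
    have hY (n : ℕ) : ∃ Y : Set {g : K → ℝ // Continuous g},
        X n ∩ Set.range clopenChar ⊆ Y ∧ HasEpsOpenPartitioning Y ε ω₁ := by
      rcases (X n ∩ Set.range clopenChar).eq_empty_or_nonempty with he | hne
      · refine ⟨{clopenChar ⊥}, by simp [he], hasEpsOpenPartitioning_of_cover
          (Set.singleton_nonempty _) (hmk _ (by simp)) fun f _ => ⟨Set.univ, isOpen_univ, trivial, ?_⟩⟩
        refine (unifDiam_le le_rfl ?_).trans_lt hε
        rintro _ ⟨-, rfl⟩ _ ⟨-, rfl⟩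
        simp [unifDist]
      · refine ⟨_, subset_rfl, hasEpsOpenPartitioning_of_cover hne
          (hmk _ Set.inter_subset_right) fun f hf => ?_⟩
        obtain ⟨𝒱, hVo, hVc, hVd⟩ := hXV n
        obtain ⟨V, hV, hfV⟩ := hVc hf.1
        exact ⟨V, hVo V hV, hfV, (unifDiam_mono
          (Set.inter_subset_inter_right _ Set.inter_subset_left)).trans_lt (hVd V hV)⟩
    choose Y hXY hY using hY
    refine ⟨Y, fun f hf => ?_, hY⟩
    obtain ⟨n, hn⟩ := Set.mem_iUnion.1 (hX.symm.subset (Set.mem_univ f))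
    exact Set.mem_iUnion.2 ⟨n, hXY n ⟨hn, exists_clopenChar_eq hf⟩⟩
  · intro h
    obtain ⟨X, hX, hXU⟩ := h 1 one_pos
    obtain ⟨N, hNfin, hN⟩ := exists_pointCountable_nhds hcard
    have hD (n : ℕ) := exists_pointwiseDiscrete_cover hNfin hN (Y := {A | clopenChar A ∈ X n})
      fun A hA => (hXU n).locally_countable hA
    choose D hDX hD using hD
    refine SLDuniform_of_pointwiseDiscrete_cover hsc
      (D := fun k => D k.unpair.1 k.unpair.2) (fun A => ?_) fun k => hD _ _
    obtain ⟨n, hn⟩ := Set.mem_iUnion.1 (hX (clopenChar_eq_zero_or_one A))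
    obtain ⟨m, hm⟩ := Set.mem_iUnion.1 (hDX n hn)
    exact ⟨Nat.pair n m, by simpa using hm⟩
end
end

section
/- Every Lindelöf scattered Tychonoff space of countable type is σ-compact. -/
open Set Topology Ordinal Cardinal

noncomputable section
universe u

/-- A space `X` is of *countable type* if every compact subset of `X` is contained in a
compact subset having countable character in `X` (a countable family of open
neighborhoods such that every open neighborhood contains one of them). -/
def CountableType (X : Type*) [TopologicalSpace X] : Prop :=
  ∀ C : Set X, IsCompact C → ∃ D : Set X, IsCompact D ∧ C ⊆ D ∧
    ∃ U : ℕ → Set X, (∀ n, IsOpen (U n) ∧ D ⊆ U n) ∧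
      ∀ V : Set X, IsOpen V → D ⊆ V → ∃ n, U n ⊆ V

/-- In a regular Lindelöf scattered space, every cover by `Gδ` sets has a countable subcover. -/
theorem IsScattered.exists_countable_iUnion_eq_univ_of_isGδ {X : Type*} [TopologicalSpace X]
    [RegularSpace X] [LindelofSpace X] (hsc : IsScattered X) {c : X → Set X}
    (hc : ∀ x, IsGδ (c x)) (hmem : ∀ x, x ∈ c x) :
    ∃ t : Set X, t.Countable ∧ ⋃ x ∈ t, c x = Set.univ := by
  let p : Set X → Prop := fun s => ∃ t : Set X, t.Countable ∧ s ⊆ ⋃ x ∈ t, c x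
  have hmono : ∀ ⦃s t⦄, s ⊆ t → p t → p s := fun s t hst ⟨a, ha, hta⟩ => ⟨a, ha, hst.trans hta⟩
  have hUnion : ∀ S : Set (Set X), S.Countable → (∀ s ∈ S, p s) → p (⋃₀ S) := by
    intro S hS h
    choose! t ht hst using h
    refine ⟨⋃ s ∈ S, t s, hS.biUnion ht, sUnion_subset fun s hs => (hst s hs).trans ?_⟩
    exact biUnion_subset_biUnion_left (subset_biUnion_of_mem hs)
  have hlocal : ∀ s : Set X, IsLindelof s → (∀ x ∈ s, ∃ u ∈ 𝓝 x, p u) → p s :=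
    fun s hs h => hs.induction_on hmono hUnion fun x hx =>
      let ⟨u, hu, hpu⟩ := h x hx
      ⟨u, mem_nhdsWithin_of_mem_nhds hu, hpu⟩
  have hall : ∀ x, ∃ u ∈ 𝓝 x, p u := by
    by_contra! hne
    obtain ⟨x, hx, W, hWo, hW⟩ := hsc {x | ∀ u ∈ 𝓝 x, ¬ p u} hne
    have hxW : x ∈ W := (hW.symm ▸ mem_singleton x : x ∈ W ∩ _).1
    obtain ⟨N, hN, hNc, hNW⟩ := exists_mem_nhds_isClosed_subset (hWo.mem_nhds hxW)
    obtain ⟨V, hVo, hV⟩ := isGδ_iff_eq_iInter_nat.1 (hc x)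
    have hdiff : ∀ n, p (N \ V n) := by
      intro n
      refine hlocal _ (hNc.sdiff (hVo n)).isLindelof fun y hy => ?_
      by_contra! hy'
      have hyx : y ∈ ({x} : Set X) := hW ▸ ⟨hNW hy.1, hy'⟩
      have hxV : x ∈ V n := mem_iInter.1 (hV ▸ hmem x) n
      exact hy.2 (mem_singleton_iff.1 hyx ▸ hxV)
    obtain ⟨t, ht, hsub⟩ := hUnion _ (countable_range fun n => N \ V n) (forall_mem_range.2 hdiff)
    refine hx N hN ⟨insert x t, ht.insert x, fun y hy => ?_⟩
    rw [biUnion_insert]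
    by_cases hyx : y ∈ c x
    · exact Or.inl hyx
    · rw [hV, mem_iInter, not_forall] at hyx
      obtain ⟨n, hn⟩ := hyx
      exact Or.inr (hsub ⟨_, mem_range_self n, hy, hn⟩)
  obtain ⟨t, ht, hsub⟩ := hlocal Set.univ isLindelof_univ fun x _ => hall x
  exact ⟨t, ht, univ_subset_iff.1 hsub⟩

/-- In a `T₁` space of countable type, every point lies in a compact `Gδ` set. -/
theorem CountableType.exists_isCompact_isGδ_mem {X : Type*} [TopologicalSpace X] [T1Space X]
    (hct : CountableType X) (x : X) : ∃ D : Set X, IsCompact D ∧ IsGδ D ∧ x ∈ D := by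
  obtain ⟨D, hD, hxD, U, hU, hbasis⟩ := hct {x} isCompact_singleton
  refine ⟨D, hD, ?_, hxD rfl⟩
  have hDU : D = ⋂ n, U n := by
    refine (subset_iInter fun n => (hU n).2).antisymm fun y hy => ?_
    by_contra hyD
    obtain ⟨n, hn⟩ := hbasis {y}ᶜ isOpen_compl_singleton (subset_compl_singleton_iff.2 hyD)
    exact hn (mem_iInter.1 hy n) rfl
  exact hDU ▸ .iInter_of_isOpen fun n => (hU n).1

/-- Every Lindelöf, scattered Tychonoff space of countable type is σ-compact. -/
theorem sigmaCompact_of_lindelof_scattered_countableType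
    (X : Type u) [TopologicalSpace X] [T35Space X] [LindelofSpace X]
    (hsc : IsScattered X) (hct : CountableType X) :
    SigmaCompactSpace X := by
  choose D hD hDG hmem using hct.exists_isCompact_isGδ_mem
  obtain ⟨t, ht, hcover⟩ := hsc.exists_countable_iUnion_eq_univ_of_isGδ hDG hmem
  refine isSigmaCompact_univ_iff.1 (hcover ▸ ?_)
  exact isSigmaCompact_biUnion ht fun x _ => (hD x).isSigmaCompact
end
end

section
/- Every Lindelöf, Čech-complete, scattered space is σ-compact. -/
open Set Topology Ordinal Cardinal

noncomputable section
universe u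

/-- A Tychonoff space is *Čech-complete* if it is a Gδ subset of its Stone–Čech
compactification. -/
def CechComplete (X : Type u) [TopologicalSpace X] : Prop :=
  IsGδ (Set.range (stoneCechUnit : X → StoneCech X))

/-- In a Lindelöf scattered regular space, a countably complete ideal of sets such that every
point lies in a Gδ member contains the whole space. -/
theorem IsScattered.univ_of_forall_exists_isGδ {X : Type*} [TopologicalSpace X] [RegularSpace X]
    [LindelofSpace X] (hsc : IsScattered X) {P : Set X → Prop}
    (mono : ∀ s t, s ⊆ t → P t → P s)
    (sUnion : ∀ S : Set (Set X), S.Countable → (∀ s ∈ S, P s) → P (⋃₀ S))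
    (hP : ∀ x, ∃ s, x ∈ s ∧ IsGδ s ∧ P s) : P univ := by
  have lindelof (K : Set X) (hK : IsClosed K) (h : ∀ x ∈ K, ∃ U ∈ 𝓝 x, P U) : P K := by
    choose! U hU hPU using h
    obtain ⟨t, htc, htK, hKt⟩ := hK.isLindelof.elim_nhds_subcover U hU
    refine mono _ _ hKt ?_
    rw [← sUnion_image]
    refine sUnion _ (htc.image U) ?_
    rintro _ ⟨x, hx, rfl⟩
    exact hPU x (htK x hx)
  refine lindelof univ isClosed_univ fun x _ => ?_
  by_contra hx
  obtain ⟨y, hy, U, hU, hUy⟩ := hsc {x | ¬ ∃ U ∈ 𝓝 x, P U} ⟨x, hx⟩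
  have hyU : y ∈ U := (hUy.ge rfl).1
  obtain ⟨V, hV, hVc, hVU⟩ := exists_mem_nhds_isClosed_subset (hU.mem_nhds hyU)
  obtain ⟨s, hys, ⟨T, hTo, hTc, rfl⟩, hPs⟩ := hP y
  have hdiff (W : Set X) (hW : W ∈ T) : P (V \ W) := by
    refine lindelof _ (hVc.sdiff (hTo W hW)) fun z hz => ?_
    by_contra hbad
    have hzy : z = y := hUy.le ⟨hVU hz.1, hbad⟩
    exact hz.2 (hzy ▸ hys W hW)
  refine hy ⟨V, hV, mono _ (⋃₀ insert (⋂₀ T) ((V \ ·) '' T)) ?_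
    (sUnion _ ((hTc.image _).insert _) ?_)⟩
  · intro z hz
    by_cases hzT : z ∈ ⋂₀ T
    · exact ⟨_, mem_insert _ _, hzT⟩
    · simp only [mem_sInter, not_forall] at hzT
      obtain ⟨W, hW, hzW⟩ := hzT
      exact ⟨V \ W, mem_insert_of_mem _ ⟨W, hW, rfl⟩, hz, hzW⟩
  · rintro _ (rfl | ⟨W, hW, rfl⟩)
    exacts [hPs, hdiff W hW]

/-- In a completely regular space, every point of a Gδ set lies in a closed Gδ subset
of it. -/
theorem IsGδ.exists_isClosed_isGδ_subset {Y : Type*} [TopologicalSpace Y]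
    [CompletelyRegularSpace Y] {s : Set Y} (hs : IsGδ s) {y : Y} (hy : y ∈ s) :
    ∃ K ⊆ s, y ∈ K ∧ IsClosed K ∧ IsGδ K := by
  obtain ⟨U, hUo, rfl⟩ := isGδ_iff_eq_iInter_nat.1 hs
  choose f hf hf0 hf1 using fun n => CompletelyRegularSpace.completely_regular y (U n)ᶜ
    (hUo n).isClosed_compl (fun h => h (mem_iInter.1 hy n))
  refine ⟨⋂ n, f n ⁻¹' {0}, iInter_mono fun n z hz => ?_, mem_iInter.2 hf0,
    isClosed_iInter fun n => isClosed_singleton.preimage (hf n),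
    IsGδ.iInter fun n => isClosed_singleton.isGδ.preimage (hf n)⟩
  by_contra hzU
  exact zero_ne_one ((show f n z = 0 from hz).symm.trans (hf1 n hzU))

/-- Every point of a Čech-complete space lies in a compact Gδ set. -/
theorem CechComplete.exists_isCompact_isGδ {X : Type u} [TopologicalSpace X]
    [CompletelyRegularSpace X] (hcc : CechComplete X) (x : X) :
    ∃ K : Set X, x ∈ K ∧ IsGδ K ∧ IsCompact K := by
  obtain ⟨K, hKs, hxK, hKc, hKG⟩ := IsGδ.exists_isClosed_isGδ_subset hcc (mem_range_self x)
  exact ⟨stoneCechUnit ⁻¹' K, hxK, hKG.preimage continuous_stoneCechUnit,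
    isInducing_stoneCechUnit.isCompact_preimage' hKc.isCompact hKs⟩

/-- Every Lindelöf, Čech-complete, scattered space is σ-compact. -/
theorem sigmaCompact_of_lindelof_cechComplete_scattered
    (X : Type u) [TopologicalSpace X] [T35Space X] [LindelofSpace X]
    (hcc : CechComplete X) (hsc : IsScattered X) :
    SigmaCompactSpace X := by
  obtain ⟨T, hT, hTu⟩ := hsc.univ_of_forall_exists_isGδ
    (P := fun s => ∃ T, IsSigmaCompact T ∧ s ⊆ T)
    (fun s t hst ⟨T, hT, htT⟩ => ⟨T, hT, hst.trans htT⟩)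
    (fun S hS h => by
      choose! T hT hsT using h
      exact ⟨⋃ s ∈ S, T s, isSigmaCompact_biUnion hS hT, by
        rw [sUnion_eq_biUnion]
        exact iUnion₂_mono hsT⟩)
    (fun x => by
      obtain ⟨K, hxK, hKG, hKc⟩ := hcc.exists_isCompact_isGδ x
      exact ⟨K, hxK, hKG, K, hKc.isSigmaCompact, subset_rfl⟩)
  exact isSigmaCompact_univ_iff.1 (univ_subset_iff.1 hTu ▸ hT)
end
end

section
/- Every Eberlein–Grothendieck scattered space that is a Lindelöf Σ-space is σ-discrete. -/
open Set Topology Ordinal Cardinal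

noncomputable section
universe u

/-- A Tychonoff space `X` is a *Lindelöf Σ-space* (countably K-determined) if there is a
separable metrizable space `M` and an upper semicontinuous map `F` from `M` to the
nonempty compact subsets of `X` whose union is all of `X`. -/
def IsLindelofSigma (X : Type u) [TopologicalSpace X] : Prop :=
  ∃ (M : Type u) (_ : TopologicalSpace M),
    TopologicalSpace.SeparableSpace M ∧ TopologicalSpace.MetrizableSpace M ∧
    ∃ F : M → Set X,
      (∀ m, (F m).Nonempty ∧ IsCompact (F m)) ∧
      (∀ m, ∀ W : Set X, IsOpen W → F m ⊆ W →
        ∃ V : Set M, IsOpen V ∧ m ∈ V ∧ ∀ m' ∈ V, F m' ⊆ W) ∧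
      (⋃ m, F m) = Set.univ

/-- A set is closed under a set-valued finitary operation `D`. -/
def IsFinClosed {Z : Type*} (D : Finset Z → Set Z) (S : Set Z) : Prop :=
  ∀ t : Finset Z, ↑t ⊆ S → D t ⊆ S

/-- The least set containing `s` that is closed under `D`. -/
def finHull {Z : Type*} (D : Finset Z → Set Z) (s : Set Z) : Set Z :=
  ⋂₀ {S | s ⊆ S ∧ IsFinClosed D S}

section Hull

variable {Z : Type u} {D : Finset Z → Set Z} {s t S : Set Z}

theorem subset_finHull : s ⊆ finHull D s :=
  subset_sInter fun _ h => h.1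

theorem finHull_subset (h : s ⊆ S) (hS : IsFinClosed D S) : finHull D s ⊆ S :=
  sInter_subset_of_mem ⟨h, hS⟩

theorem isFinClosed_finHull : IsFinClosed D (finHull D s) := fun t ht =>
  subset_sInter fun _ hS => hS.2 t (ht.trans (sInter_subset_of_mem hS))

theorem finHull_mono (h : s ⊆ t) : finHull D s ⊆ finHull D t :=
  finHull_subset (h.trans subset_finHull) isFinClosed_finHull

theorem IsFinClosed.iUnion_of_directed {ι : Type*} [Nonempty ι] {H : ι → Set Z}
    (hd : Directed (· ⊆ ·) H) (hH : ∀ i, IsFinClosed D (H i)) : IsFinClosed D (⋃ i, H i) := by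
  intro t ht
  obtain ⟨i, hi⟩ := hd.exists_mem_subset_of_finset_subset_biUnion ht
  exact (hH i t hi).trans (subset_iUnion H i)

theorem mk_finHull_le (hD : ∀ t, (D t).Countable) : #(finHull D s) ≤ max #s ℵ₀ := by
  let step : Set Z → Set Z := fun A => A ∪ ⋃ t : {t : Finset Z // ↑t ⊆ A}, D t
  have hstep : ∀ A : Set Z, #A ≤ max #s ℵ₀ → #(step A) ≤ max #s ℵ₀ := by
    intro A hA
    have hfin : #{t : Finset Z // ↑t ⊆ A} ≤ max #s ℵ₀ := by
      have h1 : #{t : Finset Z // ↑t ⊆ A} ≤ #(Finset A) := by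
        classical
        refine Cardinal.mk_le_of_injective (f := fun t => t.1.subtype (· ∈ A)) ?_
        intro t t' h
        have := congrArg (Finset.map (Function.Embedding.subtype (· ∈ A))) h
        simp only [Finset.subtype_map] at this
        rw [Finset.filter_true_of_mem (fun x hx => t.2 hx),
          Finset.filter_true_of_mem (fun x hx => t'.2 hx)] at this
        exact Subtype.ext this
      refine h1.trans ?_
      rcases finite_or_infinite A with h | h
      · exact (Cardinal.mk_le_aleph0).trans (le_max_right _ _)
      · rw [Cardinal.mk_finset_of_infinite]
        exact hA
    refine (Cardinal.mk_union_le _ _).trans ?_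
    refine Cardinal.add_le_of_le (le_max_right _ _) hA ?_
    refine (Cardinal.mk_iUnion_le _).trans ?_
    refine Cardinal.mul_le_of_le (le_max_right _ _) hfin ?_
    exact ciSup_le' fun t => ((hD t).le_aleph0).trans (le_max_right _ _)
  let A : ℕ → Set Z := fun n => step^[n] s
  have hA1 : ∀ n, A (n + 1) = step (A n) := fun n => Function.iterate_succ_apply' step n s
  have hA : ∀ n, #(A n) ≤ max #s ℵ₀ := by
    intro n
    induction n with
    | zero => exact le_max_left _ _
    | succ n ih => rw [hA1]; exact hstep _ ih
  have hmono : Monotone A := monotone_nat_of_le_succ fun n => by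
    rw [hA1]; exact subset_union_left
  have hsub : finHull D s ⊆ ⋃ n, A n := by
    refine finHull_subset (subset_iUnion A 0) ?_
    intro t ht
    obtain ⟨n, hn⟩ := hmono.directed_le.exists_mem_subset_of_finset_subset_biUnion ht
    refine subset_trans ?_ (subset_iUnion A (n + 1))
    rw [hA1]
    exact subset_union_of_subset_right
      (subset_iUnion (fun t : {t : Finset Z // ↑t ⊆ A n} => D t) ⟨t, hn⟩) _
  refine (Cardinal.mk_le_mk_of_subset hsub).trans ?_
  rw [← Equiv.ulift.{u}.surjective.iUnion_comp A]
  refine (Cardinal.mk_iUnion_le _).trans ?_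
  refine Cardinal.mul_le_of_le (le_max_right _ _) ?_ (ciSup_le' fun n => hA _)
  simp

end Hull

theorem IsScattered.exists_separating_nhds {X : Type u} [TopologicalSpace X]
    (h : IsScattered X) :
    ∃ V : X → Set X, (∀ x, IsOpen (V x) ∧ x ∈ V x) ∧
      ∀ x y, x ∈ V y → y ∈ V x → x = y := by
  classical
  have hne : ∀ S : Set X, ∃ x : Option X, S.Nonempty → ∃ y ∈ S, x = some y ∧
      ∃ U, IsOpen U ∧ U ∩ S = {y} := by
    intro S
    by_cases hS : S.Nonempty
    · obtain ⟨y, hy, U, hU⟩ := h S hS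
      exact ⟨some y, fun _ => ⟨y, hy, rfl, U, hU⟩⟩
    · exact ⟨none, fun h => absurd h hS⟩
  choose c hc using hne
  let R : (o : Ordinal.{u}) → ((b : Ordinal.{u}) → b < o → Option X) → Set X :=
    fun o f => {x | ∀ b, ∀ hb : b < o, f b hb ≠ some x}
  let E : Ordinal.{u} → Option X :=
    WellFoundedLT.fix (motive := fun _ => Option X) fun o f => c (R o f)
  let S : Ordinal.{u} → Set X := fun o => {x | ∀ b < o, E b ≠ some x}
  have hE : ∀ o, E o = c (S o) := fun o => WellFoundedLT.fix_eq _ _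
  have hex : ∃ o, S o = ∅ := by
    by_contra! hcon
    refine not_injective_of_ordinal E ?_
    intro a b hab
    have key : ∀ a b, a < b → E a ≠ E b := by
      intro a b hlt heq
      obtain ⟨y, hy, hy', -⟩ := hc _ (hcon b)
      exact hy a hlt (by rw [heq, hE, hy'])
    rcases lt_trichotomy a b with h | h | h
    · exact absurd hab (key _ _ h)
    · exact h
    · exact absurd hab.symm (key _ _ h)
  obtain ⟨o, ho⟩ := hex
  have hall : ∀ x, ∃ b, E b = some x := by
    intro x
    by_contra! hcon
    have : x ∈ S o := fun b _ => hcon b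
    simp [ho] at this
  have hx : ∀ x, ∃ b U, x ∈ S b ∧ IsOpen U ∧ U ∩ S b = {x} := by
    intro x
    have hwf : ∃ b, E b = some x ∧ ∀ b' < b, E b' ≠ some x := by
      obtain ⟨b, hb, hmin⟩ := WellFounded.has_min (wellFounded_lt (α := Ordinal.{u}))
        {b | E b = some x} (hall x)
      exact ⟨b, hb, fun b' hb' hh => hmin b' hh hb'⟩
    obtain ⟨b, hb, hmin⟩ := hwf
    obtain ⟨y, hy, hy', U, hU⟩ := hc (S b) ⟨x, hmin⟩
    obtain rfl : x = y := by
      rw [hE] at hb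
      exact Option.some_injective _ (hb.symm.trans hy')
    exact ⟨b, U, hy, hU⟩
  choose r V hr hV hVr using hx
  refine ⟨V, fun x => ⟨hV x, ?_⟩, ?_⟩
  · have : x ∈ V x ∩ S (r x) := by rw [hVr]; rfl
    exact this.1
  · have anti : ∀ a b, a ≤ b → S b ⊆ S a := fun a b hab x hx c hca => hx c (hca.trans_le hab)
    have key : ∀ x y, r x ≤ r y → y ∈ V x → y = x := by
      intro x y hle hy
      have : y ∈ V x ∩ S (r x) := ⟨hy, anti _ _ hle (hr y)⟩
      rwa [hVr] at this
    intro x y hxy hyx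
    rcases le_total (r x) (r y) with hle | hle
    · exact (key _ _ hle hyx).symm
    · exact key _ _ hle hxy

theorem IsCompact.exists_ultrafilter_le_nhds {X : Type*} [TopologicalSpace X] {C : Set X}
    (hC : IsCompact C) (U : Ultrafilter X) (hU : ∀ O, IsOpen O → C ⊆ O → O ∈ U) :
    ∃ z ∈ C, ↑U ≤ 𝓝 z := by
  by_contra! hcon
  have hO : ∀ z : X, ∃ O, z ∈ C → IsOpen O ∧ z ∈ O ∧ O ∉ U := by
    intro z
    by_cases hz : z ∈ C
    · have := hcon z hz
      rw [(nhds_basis_opens z).ge_iff] at this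
      push Not at this
      obtain ⟨O, hO, hOU⟩ := this
      exact ⟨O, fun _ => ⟨hO.2, hO.1, hOU⟩⟩
    · exact ⟨∅, fun h => absurd h hz⟩
  choose O hO using hO
  obtain ⟨t, ht, hCt⟩ := hC.elim_nhds_subcover O fun z hz => (hO z hz).1.mem_nhds (hO z hz).2.1
  have hmem := hU _ (isOpen_biUnion fun z hz => (hO z (ht z hz)).1) hCt
  obtain ⟨z, hz, hzU⟩ := (Ultrafilter.finite_biUnion_mem_iff t.finite_toSet).1 hmem
  exact (hO z (ht z hz)).2.2 hzU

/-- The compact sets of an upper semicontinuous cover have a countable outer network. -/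
theorem IsLindelofSigma.exists_countable_network {X : Type u} [TopologicalSpace X]
    (h : IsLindelofSigma X) :
    ∃ (ι : Type u) (_ : Countable ι) (N : ι → Set X), ∀ x, ∃ (v : ℕ → ι) (C : Set X),
      IsCompact C ∧ (∀ n, x ∈ N (v n)) ∧
        ∀ O, IsOpen O → C ⊆ O → ∀ᶠ n in Filter.atTop, N (v n) ⊆ O := by
  obtain ⟨M, _, hsep, hmet, F, hF, husc, hcov⟩ := h
  let := TopologicalSpace.metrizableSpaceMetric M
  have : SecondCountableTopology M := UniformSpace.secondCountable_of_separable M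
  have hB := TopologicalSpace.isBasis_countableBasis M
  refine ⟨TopologicalSpace.countableBasis M, inferInstance, fun V => ⋃ m ∈ V.1, F m, ?_⟩
  intro x
  obtain ⟨m, hm⟩ := mem_iUnion.1 (hcov.ge (mem_univ x))
  obtain ⟨W, hW⟩ := (𝓝 m).exists_antitone_basis
  have hV : ∀ n, ∃ V : TopologicalSpace.countableBasis M, m ∈ V.1 ∧ V.1 ⊆ W n := by
    intro n
    obtain ⟨V, hV, hmV, hVW⟩ := hB.mem_nhds_iff.1 (hW.1.mem_of_mem (i := n) trivial)
    exact ⟨⟨V, hV⟩, hmV, hVW⟩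
  choose v hmv hvW using hV
  refine ⟨v, F m, (hF m).2, fun n => mem_biUnion (hmv n) hm, ?_⟩
  intro O hO hFO
  obtain ⟨V, hVo, hmV, hV⟩ := husc m O hO hFO
  filter_upwards [hW.eventually_subset (hVo.mem_nhds hmV)] with n hn
  exact iUnion₂_subset fun m' hm' => hV m' (hn (hvW n hm'))

theorem exists_countable_approx {W I : Type*} [Finite I] (f : W → I → ℝ) (s : Set W) :
    ∃ c ⊆ s, c.Countable ∧ ∀ x ∈ s, ∀ ε > 0, ∃ x' ∈ c, ∀ i, |f x' i - f x i| < ε := by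
  have := Fintype.ofFinite I
  obtain ⟨t, hts, htc, hst⟩ :=
    (TopologicalSpace.IsSeparable.of_separableSpace (f '' s)).exists_countable_dense_subset
  choose g hg using fun y : t => hts y.2
  have := htc.to_subtype
  refine ⟨range g, ?_, countable_range g, ?_⟩
  · rintro _ ⟨y, rfl⟩
    exact (hg y).1
  · intro x hx ε hε
    obtain ⟨y, hy, hxy⟩ := Metric.mem_closure_iff.1 (hst (mem_image_of_mem f hx)) ε hε
    refine ⟨g ⟨y, hy⟩, mem_range_self _, fun i => ?_⟩
    rw [(hg ⟨y, hy⟩).2, abs_sub_comm, ← Real.dist_eq]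
    exact (dist_le_pi_dist (f x) y i).trans_lt hxy

section Projection

theorem eq_of_mem_closure_right {X K : Type u} {e : X → K → ℝ} [TopologicalSpace K]
    (hc : ∀ x, Continuous (e x)) {B : Set K} {x y : X}
    (h : ∀ b ∈ B, e x b = e y b) {k : K} (hk : k ∈ closure B) : e x k = e y k :=
  (isClosed_eq (hc x) (hc y)).closure_subset_iff.2 h hk

variable {X K : Type u} {e : X → K → ℝ}

/-- A countable-valued finitary operation on points and functions whose closed sets are
elementary enough to carry a projection. -/
theorem exists_approx_operation (e : X → K → ℝ) {ι : Type u} [Countable ι] (N : ι → Set X) :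
    ∃ D : Finset (X ⊕ K) → Set (X ⊕ K), (∀ t, (D t).Countable) ∧
      (∀ t i, ∀ x ∈ N i, ∀ ε > 0, ∃ x' ∈ N i, Sum.inl x' ∈ D t ∧
        ∀ b, Sum.inr b ∈ t → |e x' b - e x b| < ε) ∧
      (∀ t k, ∀ ε > 0, ∃ k', Sum.inr k' ∈ D t ∧
        ∀ a, Sum.inl a ∈ t → |e a k' - e a k| < ε) := by
  have hfr : ∀ t : Finset (X ⊕ K), Finite {b : K // Sum.inr b ∈ t} := fun t =>
    Finite.of_injective (β := t) (fun b => ⟨Sum.inr b.1, b.2⟩) fun b b' h =>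
      Subtype.ext (Sum.inr_injective (congrArg Subtype.val h))
  have hfl : ∀ t : Finset (X ⊕ K), Finite {a : X // Sum.inl a ∈ t} := fun t =>
    Finite.of_injective (β := t) (fun b => ⟨Sum.inl b.1, b.2⟩) fun b b' h =>
      Subtype.ext (Sum.inl_injective (congrArg Subtype.val h))
  choose c hcs hcc hc using fun (t : Finset (X ⊕ K)) (i : ι) =>
    exists_countable_approx (fun (x : X) (b : {b : K // Sum.inr b ∈ t}) => e x b.1) (N i)
  choose d hds hdc hd using fun (t : Finset (X ⊕ K)) =>
    exists_countable_approx (fun (k : K) (a : {a : X // Sum.inl a ∈ t}) => e a.1 k) univ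
  refine ⟨fun t => (⋃ i, Sum.inl '' c t i) ∪ Sum.inr '' d t, ?_, ?_, ?_⟩
  · exact fun t => (countable_iUnion fun i => (hcc t i).image _).union ((hdc t).image _)
  · intro t i x hx ε hε
    obtain ⟨x', hx', h⟩ := hc t i x hx ε hε
    exact ⟨x', hcs t i hx', Or.inl (mem_iUnion.2 ⟨i, mem_image_of_mem _ hx'⟩),
      fun b hb => h ⟨b, hb⟩⟩
  · intro t k ε hε
    obtain ⟨k', hk', h⟩ := hd t k (mem_univ k) ε hε
    exact ⟨k', Or.inr (mem_image_of_mem _ hk'), fun a ha => h ⟨a, ha⟩⟩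

variable [TopologicalSpace X]

theorem eq_of_mem_closure_left (he : Continuous e) {A : Set X} {k l : K}
    (h : ∀ a ∈ A, e a k = e a l) {x : X} (hx : x ∈ closure A) : e x k = e x l :=
  (isClosed_eq ((continuous_apply k).comp he) ((continuous_apply l).comp he)).closure_subset_iff.2
    h hx

variable [TopologicalSpace K]

/-- `p` projects the functions onto the closure of the functions in `S`, and is given by
composition with a map `ρ` into the closure of the points in `S`. -/
structure IsProjection (e : X → K → ℝ) (S : Set (X ⊕ K)) (p : X → X) (ρ : K → K) : Prop where
  apply_eq : ∀ x k, e (p x) k = e x (ρ k)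
  mem_closure_left : ∀ x, p x ∈ closure (Sum.inl ⁻¹' S)
  mem_closure_right : ∀ k, ρ k ∈ closure (Sum.inr ⁻¹' S)
  apply_left : ∀ a, Sum.inl a ∈ S → ∀ k, e a (ρ k) = e a k
  apply_right : ∀ b, Sum.inr b ∈ S → ∀ x, e x (ρ b) = e x b

theorem IsProjection.apply_eq_self {S : Set (X ⊕ K)} {p : X → X} {ρ : K → K}
    (h : IsProjection e S p ρ) (he : Continuous e) {x : X}
    (hx : x ∈ closure (Sum.inl ⁻¹' S)) (k : K) : e (p x) k = e x k := by
  rw [h.apply_eq]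
  exact eq_of_mem_closure_left he (fun a ha => h.apply_left a ha k) hx

theorem IsProjection.continuous {S : Set (X ⊕ K)} {p : X → X} {ρ : K → K}
    (h : IsProjection e S p ρ) (he : IsInducing e) : Continuous p := by
  rw [he.continuous_iff]
  refine continuous_pi fun k => ?_
  simp only [Function.comp_def, h.apply_eq]
  exact (continuous_apply (ρ k)).comp he.continuous

theorem exists_isProjection [CompactSpace K] (he : Continuous e) (hc : ∀ x, Continuous (e x))
    {ι : Type u} {N : ι → Set X}
    (hN : ∀ x, ∃ (v : ℕ → ι) (C : Set X), IsCompact C ∧ (∀ n, x ∈ N (v n)) ∧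
      ∀ O, IsOpen O → C ⊆ O → ∀ᶠ n in Filter.atTop, N (v n) ⊆ O)
    {D : Finset (X ⊕ K) → Set (X ⊕ K)}
    (hD₁ : ∀ t i, ∀ x ∈ N i, ∀ ε > 0, ∃ x' ∈ N i, Sum.inl x' ∈ D t ∧
        ∀ b, Sum.inr b ∈ t → |e x' b - e x b| < ε)
    (hD₂ : ∀ t k, ∀ ε > 0, ∃ k', Sum.inr k' ∈ D t ∧
        ∀ a, Sum.inl a ∈ t → |e a k' - e a k| < ε)
    {S : Set (X ⊕ K)} (hS : IsFinClosed D S) :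
    ∃ p ρ, IsProjection e S p ρ := by
  classical
  let τ := Finset S × ℕ
  let 𝒰 : Ultrafilter τ := Ultrafilter.of Filter.atTop
  have h𝒰 : ↑𝒰 ≤ (Filter.atTop : Filter τ) := Ultrafilter.of_le _
  let fs : τ → Finset (X ⊕ K) := fun i => i.1.map (Function.Embedding.subtype (· ∈ S))
  have hfs : ∀ i, ↑(fs i) ⊆ S := by
    intro i z hz
    simp only [fs, Finset.coe_map, Function.Embedding.subtype_apply, mem_image] at hz
    obtain ⟨w, -, rfl⟩ := hz
    exact w.2
  have hev : ∀ z ∈ S, ∀ᶠ i : τ in 𝒰, z ∈ fs i := by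
    intro z hz
    refine h𝒰 ?_
    filter_upwards [Filter.eventually_ge_atTop (({⟨z, hz⟩}, 0) : τ)] with i hi
    have : (⟨z, hz⟩ : S) ∈ i.1 := hi.1 (Finset.mem_singleton_self _)
    exact Finset.mem_map_of_mem _ this
  have hpos : ∀ i : τ, (0 : ℝ) < 1 / ((i.2 : ℝ) + 1) := fun i => by positivity
  have hsnd : Filter.Tendsto (fun i : τ => i.2) 𝒰 Filter.atTop :=
    Filter.Tendsto.mono_left
      (by rw [← Filter.prod_atTop_atTop_eq]; exact Filter.tendsto_snd) h𝒰
  have hlim : Filter.Tendsto (fun i : τ => 1 / ((i.2 : ℝ) + 1)) 𝒰 (𝓝 0) :=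
    tendsto_one_div_add_atTop_nhds_zero_nat.comp hsnd
  have hconv : ∀ {f : τ → ℝ} {y z : ℝ}, Filter.Tendsto f 𝒰 (𝓝 y) →
      (∀ᶠ i in 𝒰, |f i - z| < 1 / ((i.2 : ℝ) + 1)) → y = z := by
    intro f y z hy hz
    refine tendsto_nhds_unique hy ?_
    rw [tendsto_iff_dist_tendsto_zero]
    refine squeeze_zero' (Filter.Eventually.of_forall fun _ => dist_nonneg) ?_ hlim
    filter_upwards [hz] with i hi
    exact hi.le
  have hρ : ∀ k, ∃ l ∈ closure (Sum.inr ⁻¹' S), ∀ a, Sum.inl a ∈ S → e a l = e a k := by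
    intro k
    choose κ hκ hκa using fun i : τ => hD₂ (fs i) k _ (hpos i)
    obtain ⟨l, -, hl⟩ := isCompact_univ.exists_ultrafilter_le_nhds (𝒰.map κ)
      fun O _ hO => by rw [univ_subset_iff.1 hO]; exact Filter.univ_mem
    have hl' : Filter.Tendsto κ 𝒰 (𝓝 l) := hl
    refine ⟨l, mem_closure_of_tendsto hl' (Filter.Eventually.of_forall fun i =>
      hS _ (hfs i) (hκ i)), fun a ha => ?_⟩
    refine hconv (((hc a).tendsto l).comp hl') ?_
    filter_upwards [hev _ ha] with i hi
    exact hκa i a hi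
  have hp : ∀ x, ∃ z ∈ closure (Sum.inl ⁻¹' S), ∀ b, Sum.inr b ∈ S → e z b = e x b := by
    intro x
    obtain ⟨v, C, hC, hxv, hCO⟩ := hN x
    choose q hqN hq hqb using fun i : τ => hD₁ (fs i) (v i.2) x (hxv _) _ (hpos i)
    obtain ⟨z, -, hz⟩ := hC.exists_ultrafilter_le_nhds (𝒰.map q) fun O hO hCO' => by
      have : ∀ᶠ i in 𝒰, q i ∈ O := by
        filter_upwards [hsnd.eventually (hCO O hO hCO')] with i hi
        exact hi (hqN i)
      exact this
    have hz' : Filter.Tendsto q 𝒰 (𝓝 z) := hz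
    refine ⟨z, mem_closure_of_tendsto hz' (Filter.Eventually.of_forall fun i =>
      hS _ (hfs i) (hq i)), fun b hb => ?_⟩
    refine hconv ((((continuous_apply b).comp he).tendsto z).comp hz') ?_
    filter_upwards [hev _ hb] with i hi
    exact hqb i b hi
  choose ρ hρ₁ hρ₂ using hρ
  choose p hp₁ hp₂ using hp
  have happ : ∀ x k, e (p x) k = e x (ρ k) := by
    intro x k
    rw [← eq_of_mem_closure_left he (fun a ha => hρ₂ k a ha) (hp₁ x)]
    exact eq_of_mem_closure_right hc (fun b hb => hp₂ x b hb) (hρ₁ k)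
  exact ⟨p, ρ, happ, hp₁, hρ₁, fun a ha k => hρ₂ k a ha, fun b hb x => by rw [← happ, hp₂ x b hb]⟩

end Projection

/-- `Y` is a countable union of sets all of whose points have relative neighbourhoods of
small uniform diameter. -/
def HasSmallLocalDiam {X K : Type*} [TopologicalSpace X] (e : X → K → ℝ) (Y : Set X) : Prop :=
  ∀ ε > 0, ∃ T : ℕ → Set X, Y ⊆ ⋃ n, T n ∧ ∀ n, ∀ x ∈ T n, ∃ U, IsOpen U ∧ x ∈ U ∧
    ∀ y ∈ U ∩ T n, ∀ k, |e x k - e y k| ≤ ε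

section SmallLocalDiam

/-- The stages at which the projections of `x` jump by more than `δ`, together with `0`. -/
def jumps {X K : Type u} (e : X → K → ℝ) (p : Ordinal.{u} → X → X) (δ : ℝ) (x : X) : Set Ordinal.{u} :=
  {γ | γ = 0 ∨ ∃ α, γ = Order.succ α ∧ ∃ k, δ < |e (p γ x) k - e (p α x) k|}

theorem isOpen_setOf_mem_jumps {X K : Type u} [TopologicalSpace X] {e : X → K → ℝ}
    {p : Ordinal.{u} → X → X} (hp : ∀ γ, Continuous (p γ)) (he : Continuous e) (δ : ℝ)
    (γ : Ordinal.{u}) : IsOpen {x | γ ∈ jumps e p δ x} := by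
  have : {x | γ ∈ jumps e p δ x} = {_x | γ = 0} ∪ ⋃ α, ⋃ (_ : γ = Order.succ α), ⋃ k,
      {x | δ < |e (p γ x) k - e (p α x) k|} := by
    ext x
    simp [jumps]
  rw [this]
  refine isOpen_const.union (isOpen_iUnion fun α => isOpen_iUnion fun _ => isOpen_iUnion fun k => ?_)
  have hk : ∀ β, Continuous fun x => e (p β x) k := fun β =>
    (continuous_apply k).comp (he.comp (hp β))
  exact isOpen_lt continuous_const ((hk γ).sub (hk α)).abs

variable {X K : Type u} [TopologicalSpace X] [TopologicalSpace K] {e : X → K → ℝ}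

theorem hasSmallLocalDiam_closure_of_countable [CompactSpace K] (he : Continuous e)
    (hc : ∀ x, Continuous (e x)) {A : Set X} (hA : A.Countable) :
    HasSmallLocalDiam e (closure A) := by
  intro ε hε
  have := hA.to_subtype
  let φ : K → A → ℝ := fun k a => e a k
  have hφ : Continuous φ := continuous_pi fun a => hc a
  let φ' : C(K, range φ) := ⟨rangeFactorization φ, hφ.subtype_mk _⟩
  have : CompactSpace (range φ) := isCompact_iff_compactSpace.1 (isCompact_range hφ)
  have hq : IsQuotientMap φ' :=
    (φ'.continuous.isClosedMap).isQuotientMap φ'.continuous rangeFactorization_surjective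
  have hfac : ∀ x ∈ closure A, Function.FactorsThrough (⟨e x, hc x⟩ : C(K, ℝ)) φ' := by
    intro x hx k l hkl
    refine eq_of_mem_closure_left he (fun a ha => ?_) hx
    exact congrFun (congrArg Subtype.val hkl) ⟨a, ha⟩
  have hG : ∀ x ∈ closure A, ∃ g : C(range φ, ℝ), ∀ k, g (φ' k) = e x k := fun x hx =>
    ⟨hq.lift ⟨e x, hc x⟩ (hfac x hx), fun k => DFunLike.congr_fun (hq.lift_comp _ (hfac x hx)) k⟩
  let d := TopologicalSpace.denseSeq C(range φ, ℝ)
  refine ⟨fun n => {x | ∀ k, |e x k - d n (φ' k)| ≤ ε / 2}, ?_, ?_⟩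
  · intro x hx
    obtain ⟨g, hg⟩ := hG x hx
    obtain ⟨n, hn⟩ := (TopologicalSpace.denseRange_denseSeq C(range φ, ℝ)).exists_dist_lt g
      (half_pos hε)
    refine mem_iUnion.2 ⟨n, fun k => ?_⟩
    rw [← hg, ← Real.dist_eq]
    exact (ContinuousMap.dist_apply_le_dist _).trans hn.le
  · intro n x hx
    refine ⟨univ, isOpen_univ, mem_univ x, fun y hy k => ?_⟩
    have h1 := abs_le.1 (hx k)
    have h2 := abs_le.1 (hy.2 k)
    exact abs_le.2 ⟨by linarith, by linarith⟩

/-- A continuous increasing transfinite sequence of projections. -/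
structure IsProjectionChain (e : X → K → ℝ) (H : Ordinal.{u} → Set (X ⊕ K))
    (p : Ordinal.{u} → X → X) (ρ : Ordinal.{u} → K → K) : Prop where
  isProjection : ∀ γ, IsProjection e (H γ) (p γ) (ρ γ)
  mono : Monotone H
  limit : ∀ γ, Order.IsSuccLimit γ → H γ ⊆ ⋃ β < γ, H β

variable {H : Ordinal.{u} → Set (X ⊕ K)} {p : Ordinal.{u} → X → X} {ρ : Ordinal.{u} → K → K}

theorem IsProjectionChain.eventually_uniform [CompactSpace K] (h : IsProjectionChain e H p ρ)
    (he : Continuous e) (hc : ∀ x, Continuous (e x)) (x : X) {γ : Ordinal.{u}}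
    (hγ : Order.IsSuccLimit γ) {ε : ℝ} (hε : 0 < ε) :
    ∃ β < γ, ∀ α, β ≤ α → α < γ → ∀ k, |e (p α x) k - e (p γ x) k| < ε := by
  by_contra! hcon
  choose a ha haγ κ hκ using fun β : Iio γ => hcon β.1 β.2
  have : Nonempty (Iio γ) := ⟨⟨0, hγ.bot_lt⟩⟩
  let 𝒰 : Ultrafilter (Iio γ) := Ultrafilter.of Filter.atTop
  have h𝒰 : ↑𝒰 ≤ (Filter.atTop : Filter (Iio γ)) := Ultrafilter.of_le _
  have hcpt : ∀ f : Iio γ → K, ∃ l, Filter.Tendsto f 𝒰 (𝓝 l) := fun f => by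
    obtain ⟨l, -, hl⟩ := isCompact_univ.exists_ultrafilter_le_nhds (𝒰.map f)
      fun O _ hO => by rw [univ_subset_iff.1 hO]; exact Filter.univ_mem
    exact ⟨l, hl⟩
  obtain ⟨k, hk⟩ := hcpt fun β => ρ (a β) (κ β)
  obtain ⟨l, hl⟩ := hcpt fun β => ρ γ (κ β)
  have hkB : k ∈ closure (Sum.inr ⁻¹' H γ) := by
    refine isClosed_closure.mem_of_tendsto hk (Filter.Eventually.of_forall fun β => ?_)
    exact closure_mono (preimage_mono (h.mono (haγ β).le))
      ((h.isProjection _).mem_closure_right _)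
  have hlB : l ∈ closure (Sum.inr ⁻¹' H γ) :=
    isClosed_closure.mem_of_tendsto hl
      (Filter.Eventually.of_forall fun β => (h.isProjection _).mem_closure_right _)
  have heq : ∀ b, Sum.inl b ∈ H γ → e b k = e b l := by
    intro b hb
    obtain ⟨β, hβ, hbβ⟩ := mem_iUnion₂.1 (h.limit γ hγ hb)
    refine tendsto_nhds_unique_of_eventuallyEq
      (((hc b).tendsto k).comp hk) (((hc b).tendsto l).comp hl) ?_
    filter_upwards [h𝒰 (Filter.eventually_ge_atTop (⟨β, hβ⟩ : Iio γ))] with δ hδ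
    simp only [Function.comp_apply]
    rw [(h.isProjection _).apply_left b (h.mono (le_trans (Subtype.coe_le_coe.2 hδ) (ha δ)) hbβ),
      (h.isProjection _).apply_left b hb]
  have hfix : ∀ m ∈ closure (Sum.inr ⁻¹' H γ), e (p γ x) m = e x m := fun m hm =>
    eq_of_mem_closure_right hc (fun b hb => by
      rw [(h.isProjection γ).apply_eq, (h.isProjection γ).apply_right b hb]) hm
  have hkl : e x k = e x l := by
    rw [← hfix k hkB, ← hfix l hlB]
    exact eq_of_mem_closure_left he heq ((h.isProjection γ).mem_closure_left x)
  have hlim : Filter.Tendsto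
      (fun β : Iio γ => |e (p (a β) x) (κ β) - e (p γ x) (κ β)|) 𝒰 (𝓝 |e x k - e x l|) := by
    simp only [(h.isProjection _).apply_eq]
    exact ((((hc x).tendsto k).comp hk).sub (((hc x).tendsto l).comp hl)).abs
  have := ge_of_tendsto hlim (Filter.Eventually.of_forall hκ)
  rw [hkl, _root_.sub_self, abs_zero] at this
  exact absurd this hε.not_ge

theorem IsProjectionChain.finite_jumps [CompactSpace K] (h : IsProjectionChain e H p ρ)
    (he : Continuous e) (hc : ∀ x, Continuous (e x)) (x : X) {δ : ℝ} (hδ : 0 < δ)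
    (γ : Ordinal.{u}) : (jumps e p δ x ∩ Iio γ).Finite := by
  induction γ using WellFoundedLT.induction with
  | ind γ ih =>
  rcases Ordinal.zero_or_succ_or_isSuccLimit γ with rfl | ⟨β, rfl⟩ | hγ
  · convert! Set.finite_empty
    ext b
    simp
  · refine ((ih β (Order.lt_succ β)).insert β).subset ?_
    rintro b ⟨hb, hbβ⟩
    rcases (Order.lt_succ_iff.1 (mem_Iio.1 hbβ)).eq_or_lt with rfl | hlt
    · exact mem_insert _ _
    · exact Or.inr ⟨hb, hlt⟩
  · obtain ⟨β, hβ, hu⟩ := h.eventually_uniform he hc x hγ (half_pos hδ)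
    refine (ih _ (hγ.succ_lt hβ)).subset ?_
    rintro b ⟨hb, hbγ⟩
    refine ⟨hb, ?_⟩
    by_contra! hle
    have hle : Order.succ β ≤ b := not_lt.1 hle
    rcases hb with rfl | ⟨α, rfl, k, hk⟩
    · exact absurd hle (not_le.2 (Order.bot_lt_succ β))
    · have h1 := abs_lt.1 (hu _ ((Order.le_succ β).trans hle) hbγ k)
      have h2 := abs_lt.1 (hu α (Order.succ_le_succ_iff.1 hle) ((Order.lt_succ α).trans hbγ) k)
      exact absurd hk (not_lt.2 (abs_le.2 ⟨by linarith, by linarith⟩))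

theorem IsProjectionChain.exists_mem_jumps [CompactSpace K] (h : IsProjectionChain e H p ρ)
    (he : Continuous e) (hc : ∀ x, Continuous (e x)) {μ : Ordinal.{u}} (hμ : Order.IsSuccLimit μ)
    {x : X} (hx : x ∈ closure (Sum.inl ⁻¹' H μ)) {ε : ℝ} (hε : 0 < ε) :
    ∃ γ < μ, (∀ k, |e (p γ x) k - e x k| ≤ ε) ∧ ∃ n : ℕ, γ ∈ jumps e p (1 / ((n : ℝ) + 1)) x := by
  let G : Set Ordinal.{u} := {γ | ∃ δ < ε, ∀ k, |e (p γ x) k - e x k| ≤ δ}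
  have hlimit : ∀ γ ∈ G, Order.IsSuccLimit γ → ∃ β ∈ G, β < γ := by
    rintro γ ⟨δ, hδ, hγδ⟩ hγ
    obtain ⟨β, hβ, hu⟩ := h.eventually_uniform he hc x hγ (half_pos (sub_pos.2 hδ))
    refine ⟨β, ⟨(ε + δ) / 2, by linarith, fun k => ?_⟩, hβ⟩
    have h1 := abs_lt.1 (hu β le_rfl hβ k)
    have h2 := abs_le.1 (hγδ k)
    exact abs_le.2 ⟨by linarith, by linarith⟩
  have hμG : μ ∈ G := ⟨0, hε, fun k => by
    rw [(h.isProjection μ).apply_eq_self he hx, _root_.sub_self, abs_zero]⟩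
  obtain ⟨γ, hγG, hmin⟩ := WellFounded.has_min (wellFounded_lt (α := Ordinal.{u})) G ⟨μ, hμG⟩
  have hγ : ¬ Order.IsSuccLimit γ := fun hl => by
    obtain ⟨β, hβ, hlt⟩ := hlimit γ hγG hl
    exact hmin β hβ hlt
  have hγμ : γ < μ := lt_of_le_of_ne (not_lt.1 (hmin μ hμG)) fun h => hγ (h ▸ hμ)
  have hγG' := hγG
  obtain ⟨δ, hδ, hγδ⟩ := hγG
  refine ⟨γ, hγμ, fun k => (hγδ k).trans hδ.le, ?_⟩
  rcases Ordinal.zero_or_succ_or_isSuccLimit γ with rfl | ⟨α, rfl⟩ | hl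
  · exact ⟨0, Or.inl rfl⟩
  · have hα : ∃ k, e (p (Order.succ α) x) k ≠ e (p α x) k := by
      by_contra! hcon
      exact hmin α ⟨δ, hδ, fun k => by rw [← hcon]; exact hγδ k⟩ (Order.lt_succ α)
    obtain ⟨k, hk⟩ := hα
    obtain ⟨n, hn⟩ := exists_nat_one_div_lt (abs_pos.2 (sub_ne_zero.2 hk))
    exact ⟨n, Or.inr ⟨α, rfl, k, hn⟩⟩
  · exact absurd hl hγ

theorem IsProjectionChain.hasSmallLocalDiam [CompactSpace K] (h : IsProjectionChain e H p ρ)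
    (he : IsInducing e) (hc : ∀ x, Continuous (e x)) {μ : Ordinal.{u}} (hμ : Order.IsSuccLimit μ)
    (hT : ∀ γ < μ, HasSmallLocalDiam e (closure (Sum.inl ⁻¹' H γ))) :
    HasSmallLocalDiam e (closure (Sum.inl ⁻¹' H μ)) := by
  intro ε hε
  have hε3 : 0 < ε / 3 := by positivity
  choose! T hTcov hT using fun γ (hγ : γ < μ) => hT γ hγ (ε / 3) hε3
  have hp : ∀ γ, Continuous (p γ) := fun γ => (h.isProjection γ).continuous he
  let J : ℕ → X → Set Ordinal.{u} := fun n x => jumps e p (1 / ((n : ℝ) + 1)) x ∩ Iio μ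
  have hJ : ∀ n x, (J n x).Finite := fun n x =>
    h.finite_jumps he.continuous hc x (by positivity) μ
  let E : ℕ × ℕ × ℕ × ℕ → Set X := fun i => {x | ∃ γ < μ, (∀ k, |e (p γ x) k - e x k| ≤ ε / 3) ∧
    γ ∈ J i.1 x ∧ (J i.1 x).ncard = i.2.1 ∧ (J i.1 x ∩ Iio γ).ncard = i.2.2.1 ∧
    p γ x ∈ T γ i.2.2.2}
  have hrank : ∀ (F : Set Ordinal.{u}), F.Finite → ∀ a ∈ F, ∀ b,
      (F ∩ Iio a).ncard = (F ∩ Iio b).ncard → b ≤ a := by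
    intro F hF a ha b hab
    by_contra! hlt
    refine hab.not_lt (Set.ncard_lt_ncard ?_ (hF.subset inter_subset_left))
    exact ⟨fun c hc => ⟨hc.1, lt_trans hc.2 hlt⟩, fun hsub => lt_irrefl a (hsub ⟨ha, hlt⟩).2⟩
  refine ⟨fun n => E ((Denumerable.eqv (ℕ × ℕ × ℕ × ℕ)).symm n), ?_, ?_⟩
  · intro x hx
    obtain ⟨γ, hγ, hxγ, n, hn⟩ := h.exists_mem_jumps he.continuous hc hμ hx hε3
    obtain ⟨m, hm⟩ := mem_iUnion.1 (hTcov γ hγ ((h.isProjection γ).mem_closure_left x))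
    refine mem_iUnion.2 ⟨Denumerable.eqv (ℕ × ℕ × ℕ × ℕ)
      (n, (J n x).ncard, (J n x ∩ Iio γ).ncard, m), ?_⟩
    rw [Equiv.symm_apply_apply]
    exact ⟨γ, hγ, hxγ, ⟨hn, hγ⟩, rfl, rfl, hm⟩
  · intro i x hx
    beta_reduce at hx ⊢
    generalize (Denumerable.eqv (ℕ × ℕ × ℕ × ℕ)).symm i = i at hx ⊢
    obtain ⟨γ, hγ, hxγ, hγJ, hcard, hpos, hxT⟩ := hx
    obtain ⟨U, hU, hxU, hUT⟩ := hT γ hγ _ _ hxT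
    refine ⟨p γ ⁻¹' U ∩ ⋂ β ∈ J i.1 x, {y | β ∈ jumps e p (1 / ((i.1 : ℝ) + 1)) y},
      (hU.preimage (hp γ)).inter ((hJ _ _).isOpen_biInter fun β _ =>
        isOpen_setOf_mem_jumps hp he.continuous _ β),
      ⟨hxU, mem_iInter₂.2 fun β hβ => hβ.1⟩, ?_⟩
    rintro y ⟨⟨hyU, hyJ⟩, γ', hγ', hyγ, hγJ', hcard', hpos', hyT⟩ k
    have hsub : J i.1 x ⊆ J i.1 y := fun β hβ => ⟨mem_iInter₂.1 hyJ β hβ, hβ.2⟩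
    have hJeq : J i.1 x = J i.1 y :=
      Set.eq_of_subset_of_ncard_le hsub (hcard'.trans hcard.symm).le (hJ _ _)
    rw [← hJeq] at hγJ' hpos'
    obtain rfl : γ = γ' := le_antisymm
      (hrank _ (hJ i.1 x) _ hγJ' _ (hpos'.trans hpos.symm))
      (hrank _ (hJ i.1 x) _ hγJ _ (hpos.trans hpos'.symm))
    have h1 := abs_le.1 (hxγ k)
    have h2 := abs_le.1 (hyγ k)
    have h3 := abs_le.1 (hUT _ ⟨hyU, hyT⟩ k)
    exact abs_le.2 ⟨by linarith, by linarith⟩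

theorem hasSmallLocalDiam_closure [CompactSpace K] (he : IsInducing e)
    (hc : ∀ x, Continuous (e x)) {D : Finset (X ⊕ K) → Set (X ⊕ K)}
    (hD : ∀ t, (D t).Countable)
    (hproj : ∀ S, IsFinClosed D S → ∃ p ρ, IsProjection e S p ρ)
    (S : Set (X ⊕ K)) (hS : IsFinClosed D S) :
    HasSmallLocalDiam e (closure (Sum.inl ⁻¹' S)) := by
  induction hκ : #S using WellFoundedLT.induction generalizing S with
  | ind κ ih =>
  rcases le_or_gt κ ℵ₀ with hle | hgt
  · refine hasSmallLocalDiam_closure_of_countable he.continuous hc ?_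
    have : S.Countable := by rwa [← Cardinal.le_aleph0_iff_set_countable, hκ]
    exact this.preimage Sum.inl_injective
  obtain ⟨f⟩ : Nonempty (S ≃ κ.ord.ToType) := Cardinal.eq.1 (by rw [hκ, Cardinal.mk_ord_toType])
  let r : S → Ordinal.{u} := fun s => (Ordinal.ToType.mk.symm (f s)).1
  have hr : ∀ s, r s < κ.ord := fun s => (Ordinal.ToType.mk.symm (f s)).2
  have hrinj : Function.Injective r :=
    Subtype.val_injective.comp (Ordinal.ToType.mk.symm.injective.comp f.injective)
  let seed : Ordinal.{u} → Set (X ⊕ K) := fun γ => Subtype.val '' {s : S | r s < γ}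
  let H : Ordinal.{u} → Set (X ⊕ K) := fun γ => finHull D (seed γ)
  have hμ : Order.IsSuccLimit κ.ord := Cardinal.isSuccLimit_ord hgt.le
  have hseed : Monotone seed := fun a b hab => image_mono fun s (hs : r s < a) => hs.trans_le hab
  have hmono : Monotone H := fun a b hab => finHull_mono (hseed hab)
  choose p ρ hpρ using fun γ => hproj (H γ) isFinClosed_finHull
  have hchain : IsProjectionChain e H p ρ := by
    refine ⟨hpρ, hmono, fun γ hγ => ?_⟩
    have : Nonempty (Iio γ) := ⟨⟨0, hγ.bot_lt⟩⟩
    have hunion : ⋃ β < γ, H β = ⋃ β : Iio γ, H β := biUnion_eq_iUnion (Iio γ) fun β _ => H β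
    rw [hunion]
    refine finHull_subset ?_ (IsFinClosed.iUnion_of_directed ?_ fun β => isFinClosed_finHull)
    · rintro _ ⟨s, hs : r s < γ, rfl⟩
      refine mem_iUnion.2 ⟨⟨Order.succ (r s), mem_Iio.2 (hγ.succ_lt hs)⟩, subset_finHull ?_⟩
      exact ⟨s, Order.lt_succ (r s), rfl⟩
    · exact Monotone.directed_le fun a b hab => hmono hab
  have hHμ : H κ.ord = S := by
    refine subset_antisymm (finHull_subset ?_ hS) fun z hz => subset_finHull ⟨⟨z, hz⟩, hr _, rfl⟩
    rintro _ ⟨s, -, rfl⟩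
    exact s.2
  rw [← hHμ]
  refine hchain.hasSmallLocalDiam he hc hμ fun γ hγ => ih _ ?_ _ isFinClosed_finHull rfl
  refine (mk_finHull_le hD).trans_lt (max_lt ?_ hgt)
  refine lt_of_le_of_lt ?_ (Cardinal.lt_ord.1 hγ)
  refine Cardinal.mk_image_le.trans ?_
  rw [← Cardinal.mk_toType γ]
  let g : {s : S | r s < γ} → γ.ToType := fun s => Ordinal.ToType.mk ⟨r s.1, s.2⟩
  refine Cardinal.mk_le_of_injective (f := g) fun s t hst => Subtype.ext (hrinj ?_)
  exact Subtype.mk_eq_mk.1 ((Ordinal.ToType.mk (o := γ)).injective hst)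

end SmallLocalDiam

theorem HasSmallLocalDiam.isSigmaDiscrete {X K : Type u} [TopologicalSpace X] {e : X → K → ℝ}
    (h : HasSmallLocalDiam e univ) (he : IsInducing e) (hsc : IsScattered X) :
    IsSigmaDiscrete X := by
  obtain ⟨V, hV, hVsep⟩ := hsc.exists_separating_nhds
  have hball : ∀ x, ∃ n : ℕ, ∀ y, (∀ k, |e x k - e y k| ≤ 1 / ((n : ℝ) + 1)) → y ∈ V x := by
    intro x
    have hnhds : V x ∈ Filter.comap e (𝓝 (e x)) := by
      rw [← he.nhds_eq_comap]
      exact (hV x).1.mem_nhds (hV x).2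
    obtain ⟨W, hW, hWV⟩ := hnhds
    rw [nhds_pi, Filter.mem_pi] at hW
    obtain ⟨I, hI, t, ht, htW⟩ := hW
    choose δ hδ hδt using fun k => Metric.mem_nhds_iff.1 (ht k)
    have hpos : ∃ ε > 0, ∀ k ∈ I, ε < δ k := by
      have hI' : ∀ᶠ ε in 𝓝[>] (0 : ℝ), ∀ k ∈ I, ε < δ k :=
        (Filter.eventually_all_finite hI).2 fun k _ =>
          mem_nhdsWithin_of_mem_nhds (Iio_mem_nhds (hδ k))
      exact ((eventually_mem_nhdsWithin (a := (0 : ℝ)) (s := Ioi 0)).and hI').exists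
    obtain ⟨ε, hε, hεδ⟩ := hpos
    obtain ⟨n, hn⟩ := exists_nat_one_div_lt hε
    refine ⟨n, fun y hy => hWV (htW fun k hk => hδt k ?_)⟩
    rw [Metric.mem_ball, dist_comm, Real.dist_eq]
    exact ((hy k).trans hn.le).trans_lt (hεδ k hk)
  choose N hN using hball
  choose T hTcov hT using fun n : ℕ => h (1 / ((n : ℝ) + 1)) (by positivity)
  let E : ℕ × ℕ → Set X := fun i => {x | N x = i.1 ∧ x ∈ T i.1 i.2}
  refine ⟨fun n => E (Nat.pairEquiv.symm n), ?_, fun n => ?_⟩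
  · refine eq_univ_of_forall fun x => ?_
    obtain ⟨m, hm⟩ := mem_iUnion.1 (hTcov (N x) (mem_univ x))
    refine mem_iUnion.2 ⟨Nat.pairEquiv (N x, m), ?_⟩
    rw [Equiv.symm_apply_apply]
    exact ⟨rfl, hm⟩
  · generalize Nat.pairEquiv.symm n = i
    rw [discreteTopology_subtype_iff']
    rintro x ⟨hxN, hxT⟩
    obtain ⟨U, hU, hxU, hUT⟩ := hT _ _ x hxT
    refine ⟨U, hU, subset_antisymm ?_ ?_⟩
    · rintro y ⟨hyU, hyN, hyT⟩
      have hxy := hUT y ⟨hyU, hyT⟩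
      refine hVsep y x (hN x y ?_) (hN y x ?_)
      · rwa [hxN]
      · rw [hyN]
        exact fun k => abs_sub_comm (e x k) (e y k) ▸ hxy k
    · rintro _ rfl
      exact ⟨hxU, hxN, hxT⟩

/-- Every Eberlein–Grothendieck scattered space that is a Lindelöf Σ-space is
σ-discrete. -/
theorem sigmaDiscrete_of_EG_scattered_lindelofSigma
    (X : Type u) [TopologicalSpace X]
    (hEG : EberleinGrothendieck X) (hsc : IsScattered X)
    (hLS : IsLindelofSigma X) :
    IsSigmaDiscrete X := by
  obtain ⟨K, _, _, -, f, hf⟩ := hEG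
  let e : X → K → ℝ := fun x => (f x).1
  have he : IsInducing e := IsInducing.subtypeVal.comp hf.isInducing
  have hc : ∀ x, Continuous (e x) := fun x => (f x).2
  obtain ⟨ι, _, N, hN⟩ := hLS.exists_countable_network
  obtain ⟨D, hDc, hD₁, hD₂⟩ := exists_approx_operation e N
  have huniv := hasSmallLocalDiam_closure he hc hDc
    (fun S hS => exists_isProjection he.continuous hc hN hD₁ hD₂ hS) univ
    fun t _ => subset_univ _
  rw [preimage_univ, closure_univ] at huniv
  exact huniv.isSigmaDiscrete he hsc
end
end
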